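/- arXiv:1910.13221 — 8 statements merged into one kernel-verified Lean document; each statement's English description precedes it below -/
import Mathlib

section
/- Let G be a finitely generated group, K a finite field, A a finite set, and X ⊆ A^G a Lie algebraic G-subshift over K. If the homoclinic group Δ_X is dense in X and Δ_X is finitely orbit-generated as a subgroup of (X, +), then X is cellwiseable, i.e., there exist a finite Lie algebra B over K, a closed G-invariant Lie subalgebra Y of B^G with coordinatewise operations, and a G-equivariant homeomorphism X → Y that is also a Lie algebra isomorphism. -/
/-- The left shift action on the full shift `A^G`: `(g • x) h = x (g⁻¹ h)`. -/
def shiftMap {G A : Type} [Group G] (g : G) (x : G → A) : G → A :=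
  fun h => x (g⁻¹ * h)

/-- A Lie algebraic `G`-subshift over `K`: a closed shift-invariant subset `X ⊆ A^G`
equipped with continuous `G`-equivariant operations (zero, addition, negation, scalar
multiplication by elements of `K`, and a bracket) making `X` a Lie algebra over `K`.
The operations are given as (arbitrary extensions of) maps on the ambient space; all
conditions are imposed on `X`, where the operations are defined. -/
structure LieAlgSubshift (K : Type) [Field K] (G : Type) [Group G]
    (A : Type) [TopologicalSpace A] where
  X : Set (G → A)
  closed : IsClosed X
  shift_mem : ∀ (g : G), ∀ x ∈ X, shiftMap g x ∈ X
  zero : G → A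
  zero_mem : zero ∈ X
  zero_shift : ∀ g : G, shiftMap g zero = zero
  add : (G → A) → (G → A) → (G → A)
  add_mem : ∀ x ∈ X, ∀ y ∈ X, add x y ∈ X
  add_contOn : ContinuousOn (fun p : (G → A) × (G → A) => add p.1 p.2) (X ×ˢ X)
  add_shift : ∀ (g : G), ∀ x ∈ X, ∀ y ∈ X,
    shiftMap g (add x y) = add (shiftMap g x) (shiftMap g y)
  neg : (G → A) → (G → A)
  neg_mem : ∀ x ∈ X, neg x ∈ X
  neg_contOn : ContinuousOn neg X
  neg_shift : ∀ (g : G), ∀ x ∈ X, shiftMap g (neg x) = neg (shiftMap g x)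
  smul : K → (G → A) → (G → A)
  smul_mem : ∀ (c : K), ∀ x ∈ X, smul c x ∈ X
  smul_contOn : ∀ c : K, ContinuousOn (smul c) X
  smul_shift : ∀ (c : K) (g : G), ∀ x ∈ X, shiftMap g (smul c x) = smul c (shiftMap g x)
  br : (G → A) → (G → A) → (G → A)
  br_mem : ∀ x ∈ X, ∀ y ∈ X, br x y ∈ X
  br_contOn : ContinuousOn (fun p : (G → A) × (G → A) => br p.1 p.2) (X ×ˢ X)
  br_shift : ∀ (g : G), ∀ x ∈ X, ∀ y ∈ X,
    shiftMap g (br x y) = br (shiftMap g x) (shiftMap g y)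
  -- vector space axioms
  add_assoc' : ∀ x ∈ X, ∀ y ∈ X, ∀ z ∈ X, add (add x y) z = add x (add y z)
  add_comm' : ∀ x ∈ X, ∀ y ∈ X, add x y = add y x
  zero_add' : ∀ x ∈ X, add zero x = x
  neg_add' : ∀ x ∈ X, add (neg x) x = zero
  one_smul' : ∀ x ∈ X, smul 1 x = x
  zero_smul' : ∀ x ∈ X, smul 0 x = zero
  mul_smul' : ∀ (a b : K), ∀ x ∈ X, smul (a * b) x = smul a (smul b x)
  smul_add' : ∀ (a : K), ∀ x ∈ X, ∀ y ∈ X, smul a (add x y) = add (smul a x) (smul a y)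
  add_smul' : ∀ (a b : K), ∀ x ∈ X, smul (a + b) x = add (smul a x) (smul b x)
  -- Lie bracket axioms
  br_add_left : ∀ x ∈ X, ∀ y ∈ X, ∀ z ∈ X, br (add x y) z = add (br x z) (br y z)
  br_add_right : ∀ x ∈ X, ∀ y ∈ X, ∀ z ∈ X, br z (add x y) = add (br z x) (br z y)
  br_smul_left : ∀ (a : K), ∀ x ∈ X, ∀ y ∈ X, br (smul a x) y = smul a (br x y)
  br_smul_right : ∀ (a : K), ∀ x ∈ X, ∀ y ∈ X, br x (smul a y) = smul a (br x y)
  br_self : ∀ x ∈ X, br x x = zero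
  jacobi : ∀ x ∈ X, ∀ y ∈ X, ∀ z ∈ X,
    add (br (br x y) z) (add (br (br y z) x) (br (br z x) y)) = zero

namespace LieAlgSubshift

variable {K : Type} [Field K] {G : Type} [Group G] {A : Type} [TopologicalSpace A]

/-- The homoclinic group `Δ_X`: points of `X` that agree with the zero configuration
in all but finitely many coordinates. -/
def delta (S : LieAlgSubshift K G A) : Set (G → A) :=
  {x | x ∈ S.X ∧ {g : G | x g ≠ S.zero g}.Finite}

/-- The subgroup of `(X, +)` generated by the `G`-translates of elements of `F`. -/
inductive orbitGen (S : LieAlgSubshift K G A) (F : Set (G → A)) : (G → A) → Prop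
  | base (g : G) (y : G → A) (hy : y ∈ F) : orbitGen S F (shiftMap g y)
  | zero : orbitGen S F S.zero
  | add (x y : G → A) : orbitGen S F x → orbitGen S F y → orbitGen S F (S.add x y)
  | neg (x : G → A) : orbitGen S F x → orbitGen S F (S.neg x)

/-- A shift-invariant subset `Y ⊆ X` is finitely orbit-generated if it equals the
subgroup of `(X, +)` generated by the `G`-orbits of a finite subset `F ⊆ Y`. -/
def FinitelyOrbitGenerated (S : LieAlgSubshift K G A) (Y : Set (G → A)) : Prop :=
  ∃ F : Set (G → A), F.Finite ∧ F ⊆ Y ∧ ∀ x, x ∈ Y ↔ S.orbitGen F x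

end LieAlgSubshift

/-- A cellwise Lie algebraic `G`-subshift: a finite Lie algebra `B` over `K` (with the
discrete topology) and a closed shift-invariant subset `Y ⊆ B^G` closed under the
coordinatewise Lie algebra operations of `B`. -/
structure CellwiseLieSubshift (K : Type) [Field K] (G : Type) [Group G] where
  B : Type
  [fintypeB : Fintype B]
  [topB : TopologicalSpace B]
  discreteB : DiscreteTopology B
  [lieRingB : LieRing B]
  [lieAlgebraB : LieAlgebra K B]
  Y : Set (G → B)
  closed : IsClosed Y
  shift_mem : ∀ (g : G), ∀ y ∈ Y, shiftMap g y ∈ Y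
  zero_mem : (fun _ => (0 : B)) ∈ Y
  add_mem : ∀ x ∈ Y, ∀ y ∈ Y, (fun h => x h + y h) ∈ Y
  neg_mem : ∀ x ∈ Y, (fun h => -(x h)) ∈ Y
  smul_mem : ∀ (c : K), ∀ x ∈ Y, (fun h => c • x h) ∈ Y
  br_mem : ∀ x ∈ Y, ∀ y ∈ Y, (fun h => ⁅x h, y h⁆) ∈ Y

attribute [instance] CellwiseLieSubshift.fintypeB CellwiseLieSubshift.topB
  CellwiseLieSubshift.lieRingB CellwiseLieSubshift.lieAlgebraB

/-- `X` is cellwiseable if there is a cellwise Lie algebraic `G`-subshift `Y ⊆ B^G`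
and a `G`-equivariant homeomorphism `X → Y` that is also a Lie algebra isomorphism. -/
def LieAlgSubshift.Cellwiseable {K : Type} [Field K] {G : Type} [Group G]
    {A : Type} [TopologicalSpace A] (S : LieAlgSubshift K G A) : Prop :=
  ∃ (C : CellwiseLieSubshift K G) (φ : (G → A) → (G → C.B)) (ψ : (G → C.B) → (G → A)),
    Set.BijOn φ S.X C.Y ∧
    ContinuousOn φ S.X ∧
    Set.InvOn ψ φ S.X C.Y ∧
    ContinuousOn ψ C.Y ∧
    (∀ (g : G), ∀ x ∈ S.X, φ (shiftMap g x) = shiftMap g (φ x)) ∧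
    φ S.zero = (fun _ => (0 : C.B)) ∧
    (∀ x ∈ S.X, ∀ y ∈ S.X, φ (S.add x y) = fun h => φ x h + φ y h) ∧
    (∀ x ∈ S.X, φ (S.neg x) = fun h => -(φ x h)) ∧
    (∀ (c : K), ∀ x ∈ S.X, φ (S.smul c x) = fun h => c • φ x h) ∧
    (∀ x ∈ S.X, ∀ y ∈ S.X, φ (S.br x y) = fun h => ⁅φ x h, φ y h⁆)

namespace LieCell

section Abstract

variable {K L : Type} [Field K] [LieRing L] [LieAlgebra K L]

/-- Iterated bracket `⁅x₁, ⁅x₂, … ⁅xₙ, y⁆⁆⁆`. -/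
def act (l : List L) (y : L) : L := l.foldr (fun x z => ⁅x, z⁆) y

theorem act_cons (x : L) (l : List L) (y : L) : act (x :: l) y = ⁅x, act l y⁆ := rfl

theorem act_append (l l' : List L) (y : L) : act (l ++ l') y = act l (act l' y) := by
  simp [act, List.foldr_append]

theorem act_add (l : List L) (y z : L) : act l (y + z) = act l y + act l z := by
  induction l with
  | nil => rfl
  | cons x l ih => simp [act_cons, ih]

theorem act_smul (l : List L) (c : K) (y : L) : act l (c • y) = c • act l y := by
  induction l with
  | nil => rfl
  | cons x l ih => simp [act_cons, ih]

theorem act_zero (l : List L) : act l (0 : L) = 0 := by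
  induction l with
  | nil => rfl
  | cons x l ih => simp [act_cons, ih]

theorem act_perm (V : Submodule K L) (y : L) (n : ℕ)
    (hn : ∀ l : List L, l.length < n → act l y ∈ V) {l l' : List L} (h : l.Perm l') :
    ∀ p : List L, p.length + l.length = n → act (p ++ l) y - act (p ++ l') y ∈ V := by
  induction h with
  | nil => intro p _; simp
  | cons a h ih =>
    intro p hp
    have := ih (p ++ [a]) (by simp at hp ⊢; omega)
    simpa using this
  | swap a b l =>
    intro p hp
    have h1 : act (p ++ b :: a :: l) y - act (p ++ a :: b :: l) y = act (p ++ ⁅b, a⁆ :: l) y := by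
      rw [sub_eq_iff_eq_add, act_append, act_append, act_append, ← act_add]
      congr 1
      simp only [act_cons]
      exact leibniz_lie b a _
    rw [h1]
    apply hn
    simp at hp ⊢; omega
  | trans h1 h2 ih1 ih2 =>
    intro p hp
    have := V.add_mem (ih1 p hp) (ih2 p (by rw [← h1.length_eq]; exact hp))
    simpa using this

/-- sorted word -/
def mono (C : List L) (a : L → ℕ) : List L := C.flatMap fun c => List.replicate (a c) c

theorem perm_mono [DecidableEq L] (C : List L) (hC : C.Nodup) (l : List L) (hl : ∀ x ∈ l, x ∈ C) :
    l.Perm (mono C (fun c => l.count c)) := by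
  rw [List.perm_iff_count]
  intro x
  have key : ∀ C : List L, C.Nodup →
      (mono C (fun c => l.count c)).count x = if x ∈ C then l.count x else 0 := by
    intro C
    induction C with
    | nil => intro _; simp [mono]
    | cons c C ih =>
      intro h
      have h' := List.nodup_cons.1 h
      have e : mono (c :: C) (fun c => l.count c)
        = List.replicate (l.count c) c ++ mono C (fun c => l.count c) := by simp [mono]
      rw [e, List.count_append, ih h'.2, List.count_replicate]
      by_cases hx : c = x
      · subst hx; simp [h'.1]
      · have : x ≠ c := fun h => hx h.symm
        simp [hx, this]
  rw [key C hC]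
  split_ifs with h
  · rfl
  · exact List.count_eq_zero.2 fun hx => h (hl x hx)

theorem words_mem (V : Submodule K L) (C : List L) (hC : C.Nodup)
    (hZ : ∀ x : L, ∃ c ∈ C, ∀ y : L, ⁅x - c, y⁆ ∈ V) (y : L)
    (hy : ∀ a : L → ℕ, act (mono C a) y ∈ V) : ∀ l : List L, act l y ∈ V := by
  classical
  suffices H : ∀ n : ℕ, ∀ l : List L, l.length = n → act l y ∈ V from fun l => H _ l rfl
  intro n
  induction n using Nat.strong_induction_on with
  | _ n ih =>
    have hn : ∀ l : List L, l.length < n → act l y ∈ V := fun l hl => ih _ hl l rfl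
    have base : ∀ l : List L, l.length = n → (∀ x ∈ l, x ∈ C) → act l y ∈ V := by
      intro l hl hlC
      have := act_perm V y n hn (perm_mono C hC l hlC) [] (by simpa using hl)
      simpa using V.add_mem this (hy (fun c => l.count c))
    have step : ∀ l p : List L, p.length + l.length = n → (∀ x ∈ p, x ∈ C) →
        act (p ++ l) y ∈ V := by
      intro l
      induction l with
      | nil => intro p hp hpC; simpa using base p (by simpa using hp) hpC
      | cons x l ihl =>
        intro p hp hpC
        obtain ⟨c, hc, hcz⟩ := hZ x
        have e : act (p ++ x :: l) y = act (p ++ c :: l) y + act (p ++ (x - c) :: l) y := by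
          simp only [act_append, act_cons, ← act_add, ← add_lie]
          simp
        rw [e]
        apply V.add_mem
        · have := ihl (p ++ [c]) (by simp at hp ⊢; omega) (by
            intro z hz
            rcases List.mem_append.1 hz with h | h
            · exact hpC z h
            · rw [List.mem_singleton.1 h]; exact hc)
          simpa using this
        · have hp' : (p ++ (x - c) :: l).Perm ((x - c) :: (p ++ l)) := List.perm_middle
          have := act_perm V y n hn hp' [] (by simp at hp ⊢; omega)
          have := V.add_mem this (hcz (act (p ++ l) y))
          simpa [act_cons] using this
    intro l hl
    simpa using step l [] (by simpa using hl) (by simp)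

theorem finite_iter (d : L) (hd : (Set.range fun y : L => ⁅d, y⁆).Finite) :
    (Set.range fun n : ℕ => fun y : L => act (List.replicate n d) y).Finite := by
  classical
  set R := Set.range fun y : L => ⁅d, y⁆ with hR
  have : Finite R := hd
  have hmem : ∀ (n : ℕ) (y : R), act (List.replicate n d) (y : L) ∈ R := by
    intro n y
    cases n with
    | zero => exact y.2
    | succ n => exact ⟨_, rfl⟩
  let e : (R → R) → L → L := fun f y => f ⟨⁅d, y⁆, ⟨y, rfl⟩⟩
  refine ((Set.finite_singleton (fun y : L => y)).union (Set.finite_range e)).subset ?_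
  rintro _ ⟨n, rfl⟩
  cases n with
  | zero => left; rfl
  | succ n =>
    right
    refine ⟨fun y => ⟨_, hmem n y⟩, ?_⟩
    funext y
    simp only [e]
    rw [List.replicate_succ', act_append]
    rfl

theorem finite_mono (C : List L) (hC : ∀ d ∈ C, (Set.range fun y : L => ⁅d, y⁆).Finite) :
    (Set.range fun a : L → ℕ => fun y : L => act (mono C a) y).Finite := by
  induction C with
  | nil =>
    refine (Set.finite_singleton (fun y : L => y)).subset ?_
    rintro _ ⟨a, rfl⟩; rfl
  | cons c C ih =>
    have h1 := finite_iter c (hC c (by simp))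
    have h2 := ih (fun d hd => hC d (by simp [hd]))
    refine (Set.Finite.image2 (fun f g => f ∘ g) h1 h2).subset ?_
    rintro _ ⟨a, rfl⟩
    refine ⟨_, ⟨a c, rfl⟩, _, ⟨a, rfl⟩, ?_⟩
    funext y
    simp [mono, act_append]

variable [TopologicalSpace L] [CompactSpace L] [IsTopologicalAddGroup L]

theorem isOpen_forall_lie (hbr : Continuous fun p : L × L => ⁅p.1, p.2⁆) (U : Set L)
    (hU : IsOpen U) : IsOpen {x : L | ∀ y, ⁅x, y⁆ ∈ U} := by
  have hc : IsClosed {p : L × L | ⁅p.1, p.2⁆ ∈ Uᶜ} := hU.isClosed_compl.preimage hbr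
  have := isClosedMap_fst_of_compactSpace _ hc
  rw [← isClosed_compl_iff]
  convert this using 1
  ext x
  simp

theorem act_continuous (hbr : Continuous fun p : L × L => ⁅p.1, p.2⁆) (l : List L) :
    Continuous fun y : L => act l y := by
  induction l with
  | nil => exact continuous_id
  | cons x l ih => exact hbr.comp (continuous_const.prodMk ih)

theorem exists_open_ideal (hbr : Continuous fun p : L × L => ⁅p.1, p.2⁆) (D : Set L)
    (hD : Dense D) (hfin : ∀ d ∈ D, (Set.range fun y : L => ⁅d, y⁆).Finite)
    (V : Submodule K L) (hV : IsOpen (V : Set L)) :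
    ∃ I : LieIdeal K L, IsOpen (I : Set L) ∧ ∀ x ∈ I, x ∈ V := by
  classical
  have hZo := isOpen_forall_lie hbr (V : Set L) hV
  set Z := {x : L | ∀ y, ⁅x, y⁆ ∈ (V : Set L)} with hZdef
  obtain ⟨t, ht⟩ := isCompact_univ.elim_finite_subcover (fun d : D => {x : L | x - d ∈ Z})
    (fun d => hZo.preimage (continuous_id.sub continuous_const)) (by
      intro x _
      have ho : IsOpen {d : L | x - d ∈ Z} := hZo.preimage (continuous_const.sub continuous_id)
      obtain ⟨d, hd, hdD⟩ := hD.inter_open_nonempty _ ho ⟨x, by simp [Z]⟩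
      exact Set.mem_iUnion.2 ⟨⟨d, hdD⟩, hd⟩)
  let C : List L := (t.image Subtype.val).toList
  have hCn : C.Nodup := Finset.nodup_toList _
  have hCD : ∀ c ∈ C, c ∈ D := by
    intro c hc
    simp only [C, Finset.mem_toList, Finset.mem_image] at hc
    obtain ⟨a, -, rfl⟩ := hc
    exact a.2
  have hCZ : ∀ x : L, ∃ c ∈ C, ∀ y : L, ⁅x - c, y⁆ ∈ V := by
    intro x
    obtain ⟨d, hd⟩ := Set.mem_iUnion.1 (ht (Set.mem_univ x))
    obtain ⟨hdt, hd⟩ := Set.mem_iUnion.1 hd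
    exact ⟨d, by simp only [C, Finset.mem_toList, Finset.mem_image]; exact ⟨d, hdt, rfl⟩, hd⟩
  let I : LieIdeal K L :=
    { carrier := {y | ∀ l : List L, act l y ∈ V}
      add_mem' := fun {a b} ha hb l => by rw [act_add]; exact V.add_mem (ha l) (hb l)
      zero_mem' := fun l => by rw [act_zero]; exact V.zero_mem
      smul_mem' := fun c x hx l => by rw [act_smul]; exact V.smul_mem c (hx l)
      lie_mem := fun {x m} hm l => by
        have := hm (l ++ [x])
        rwa [act_append] at this }
  refine ⟨I, ?_, fun x hx => hx []⟩
  have hI : (I : Set L) = ⋂ f ∈ (Set.range fun a : L → ℕ => fun y : L => act (mono C a) y),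
      f ⁻¹' (V : Set L) := by
    ext y
    simp only [Set.mem_iInter, Set.mem_range, forall_exists_index, forall_apply_eq_imp_iff,
      Set.mem_preimage, SetLike.mem_coe]
    exact ⟨fun h a => h _, fun h => words_mem V C hCn hCZ y h⟩
  rw [hI]
  refine (finite_mono C fun d hd => hfin d (hCD d hd)).isOpen_biInter ?_
  rintro _ ⟨a, rfl⟩
  exact hV.preimage (act_continuous hbr _)

theorem exists_open_submodule [Finite K] [TotallyDisconnectedSpace L]
    (hs : ∀ c : K, Continuous fun x : L => c • x) (U : Set L) (hU : IsOpen U) (h0 : (0 : L) ∈ U) :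
    ∃ V : Submodule K L, IsOpen (V : Set L) ∧ (V : Set L) ⊆ U := by
  obtain ⟨H, hH⟩ :=
    ProfiniteGrp.exist_openNormalAddSubgroup_sub_open_nhds_of_zero hU h0
  refine ⟨{ carrier := {x | ∀ c : K, c • x ∈ H}
            add_mem' := fun {a b} ha hb c => by rw [smul_add]; exact add_mem (ha c) (hb c)
            zero_mem' := fun c => by rw [smul_zero]; exact zero_mem H
            smul_mem' := fun c x hx d => by rw [smul_smul]; exact hx _ }, ?_, ?_⟩
  · have : {x : L | ∀ c : K, c • x ∈ H} = ⋂ c : K, (fun x : L => c • x) ⁻¹' (H : Set L) := by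
      ext; simp
    change IsOpen {x : L | ∀ c : K, c • x ∈ H}
    rw [this]
    exact isOpen_iInter_of_finite fun c => H.isOpen'.preimage (hs c)
  · intro x hx
    have := hx 1
    rw [one_smul] at this
    exact hH this

end Abstract

section Concrete

variable {K : Type} [Field K] {G : Type} [Group G] {A : Type} [TopologicalSpace A]

instance instAdd (S : LieAlgSubshift K G A) : Add S.X where
  add x y := ⟨S.add x y, S.add_mem _ x.2 _ y.2⟩

instance instZero (S : LieAlgSubshift K G A) : Zero S.X where
  zero := ⟨S.zero, S.zero_mem⟩

instance instNeg (S : LieAlgSubshift K G A) : Neg S.X where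
  neg x := ⟨S.neg x, S.neg_mem _ x.2⟩

instance instGrp (S : LieAlgSubshift K G A) : AddCommGroup S.X where
  add_assoc x y z := Subtype.ext (S.add_assoc' _ x.2 _ y.2 _ z.2)
  add_comm x y := Subtype.ext (S.add_comm' _ x.2 _ y.2)
  zero_add x := Subtype.ext (S.zero_add' _ x.2)
  add_zero x := Subtype.ext ((S.add_comm' _ x.2 _ S.zero_mem).trans (S.zero_add' _ x.2))
  neg_add_cancel x := Subtype.ext (S.neg_add' _ x.2)
  nsmul := nsmulRec
  zsmul := zsmulRec

instance instMod (S : LieAlgSubshift K G A) : Module K S.X where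
  smul c x := ⟨S.smul c x, S.smul_mem c _ x.2⟩
  one_smul x := Subtype.ext (S.one_smul' _ x.2)
  mul_smul a b x := Subtype.ext (S.mul_smul' a b _ x.2)
  smul_add a x y := Subtype.ext (S.smul_add' a _ x.2 _ y.2)
  add_smul a b x := Subtype.ext (S.add_smul' a b _ x.2)
  zero_smul x := Subtype.ext (S.zero_smul' _ x.2)
  smul_zero a := by
    have h : ∀ x y : S.X, (⟨S.smul a (S.add x y), S.smul_mem a _ (S.add_mem _ x.2 _ y.2)⟩ : S.X)
        = (⟨S.smul a x, S.smul_mem a _ x.2⟩ : S.X) + ⟨S.smul a y, S.smul_mem a _ y.2⟩ :=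
      fun x y => Subtype.ext (S.smul_add' a _ x.2 _ y.2)
    have h0 := h 0 0
    have e : S.add (0 : S.X) (0 : S.X) = ((0 : S.X) : G → A) := S.zero_add' _ S.zero_mem
    simp only [e] at h0
    exact left_eq_add.1 h0

instance instBr (S : LieAlgSubshift K G A) : Bracket S.X S.X where
  bracket x y := ⟨S.br x y, S.br_mem _ x.2 _ y.2⟩

theorem bal (S : LieAlgSubshift K G A) (x y z : S.X) : ⁅x + y, z⁆ = ⁅x, z⁆ + ⁅y, z⁆ :=
  Subtype.ext (S.br_add_left _ x.2 _ y.2 _ z.2)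

theorem bar (S : LieAlgSubshift K G A) (x y z : S.X) : ⁅x, y + z⁆ = ⁅x, y⁆ + ⁅x, z⁆ :=
  Subtype.ext (S.br_add_right _ y.2 _ z.2 _ x.2)

theorem bself (S : LieAlgSubshift K G A) (x : S.X) : ⁅x, x⁆ = 0 :=
  Subtype.ext (S.br_self _ x.2)

theorem bskew (S : LieAlgSubshift K G A) (x y : S.X) : ⁅x, y⁆ = -⁅y, x⁆ := by
  have h := bself S (x + y)
  rw [bal, bar, bar, bself, bself, zero_add, add_zero] at h
  exact eq_neg_of_add_eq_zero_left h

theorem bneg (S : LieAlgSubshift K G A) (x y : S.X) : ⁅-x, y⁆ = -⁅x, y⁆ := by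
  apply eq_neg_of_add_eq_zero_left
  rw [← bal, neg_add_cancel]
  have h := bal S 0 0 y
  rw [add_zero] at h
  exact left_eq_add.1 h

theorem bjac (S : LieAlgSubshift K G A) (x y z : S.X) :
    ⁅⁅x, y⁆, z⁆ + (⁅⁅y, z⁆, x⁆ + ⁅⁅z, x⁆, y⁆) = 0 :=
  Subtype.ext (S.jacobi _ x.2 _ y.2 _ z.2)

instance instLieRing (S : LieAlgSubshift K G A) : LieRing S.X where
  add_lie := bal S
  lie_add := bar S
  lie_self := bself S
  leibniz_lie x y z := by
    have h := bjac S x y z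
    have h1 : ⁅⁅z, x⁆, y⁆ = ⁅y, ⁅x, z⁆⁆ := by
      rw [bskew S z x, bneg, ← bskew S y]
    rw [bskew S ⁅y, z⁆ x, h1] at h
    have h2 := eq_neg_of_add_eq_zero_left h
    rw [h2]
    abel

instance instLieAlg (S : LieAlgSubshift K G A) : LieAlgebra K S.X where
  lie_smul a x y := Subtype.ext (S.br_smul_right a _ x.2 _ y.2)

theorem cont_add (S : LieAlgSubshift K G A) : Continuous fun p : S.X × S.X => p.1 + p.2 := by
  refine Continuous.subtype_mk ?_ _
  exact S.add_contOn.comp_continuous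
    ((continuous_subtype_val.comp continuous_fst).prodMk
      (continuous_subtype_val.comp continuous_snd)) (fun p => ⟨p.1.2, p.2.2⟩)

theorem cont_br (S : LieAlgSubshift K G A) : Continuous fun p : S.X × S.X => ⁅p.1, p.2⁆ := by
  refine Continuous.subtype_mk ?_ _
  exact S.br_contOn.comp_continuous
    ((continuous_subtype_val.comp continuous_fst).prodMk
      (continuous_subtype_val.comp continuous_snd)) (fun p => ⟨p.1.2, p.2.2⟩)

theorem cont_neg (S : LieAlgSubshift K G A) : Continuous fun p : S.X => -p :=
  Continuous.subtype_mk (S.neg_contOn.comp_continuous continuous_subtype_val fun p => p.2) _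

theorem cont_smul (S : LieAlgSubshift K G A) (c : K) : Continuous fun p : S.X => c • p :=
  Continuous.subtype_mk ((S.smul_contOn c).comp_continuous continuous_subtype_val fun p => p.2) _

instance instTop (S : LieAlgSubshift K G A) : IsTopologicalAddGroup S.X where
  continuous_add := cont_add S
  continuous_neg := cont_neg S

/-- The shift on the subshift. -/
def sh (S : LieAlgSubshift K G A) (g : G) (x : S.X) : S.X :=
  ⟨shiftMap g x, S.shift_mem g _ x.2⟩

theorem cont_sh (S : LieAlgSubshift K G A) (g : G) : Continuous (sh S g) := by
  refine Continuous.subtype_mk ?_ _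
  refine continuous_pi fun h => ?_
  exact (continuous_apply (g⁻¹ * h)).comp continuous_subtype_val

theorem sh_br (S : LieAlgSubshift K G A) (g : G) (x y : S.X) :
    sh S g ⁅x, y⁆ = ⁅sh S g x, sh S g y⁆ := Subtype.ext (S.br_shift g _ x.2 _ y.2)

theorem sh_add (S : LieAlgSubshift K G A) (g : G) (x y : S.X) :
    sh S g (x + y) = sh S g x + sh S g y := Subtype.ext (S.add_shift g _ x.2 _ y.2)

theorem sh_neg (S : LieAlgSubshift K G A) (g : G) (x : S.X) :
    sh S g (-x) = - sh S g x := Subtype.ext (S.neg_shift g _ x.2)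

theorem sh_smul (S : LieAlgSubshift K G A) (g : G) (c : K) (x : S.X) :
    sh S g (c • x) = c • sh S g x := Subtype.ext (S.smul_shift c g _ x.2)

theorem sh_zero (S : LieAlgSubshift K G A) (g : G) :
    sh S g 0 = 0 := Subtype.ext (S.zero_shift g)

theorem zero_const (S : LieAlgSubshift K G A) (g : G) : S.zero g = S.zero 1 := by
  have := congrFun (S.zero_shift g) g
  simpa [shiftMap] using this.symm

theorem sh_inv_one (S : LieAlgSubshift K G A) (g : G) (x : S.X) :
    (sh S g⁻¹ x : G → A) 1 = (x : G → A) g := by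
  simp [sh, shiftMap]

variable [Finite A] [DiscreteTopology A]

theorem open_U (S : LieAlgSubshift K G A) :
    IsOpen {x : S.X | (x : G → A) 1 = S.zero 1} := by
  have h : Continuous fun x : S.X => (x : G → A) 1 :=
    (continuous_apply (1 : G)).comp continuous_subtype_val
  exact (isOpen_discrete ({S.zero 1} : Set A)).preimage h

instance instCompact (S : LieAlgSubshift K G A) : CompactSpace S.X :=
  isCompact_iff_compactSpace.1 S.closed.isCompact

theorem finite_range_br (S : LieAlgSubshift K G A) (d : S.X) (hd : (d : G → A) ∈ S.delta) :
    (Set.range fun y : S.X => ⁅d, y⁆).Finite := by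
  classical
  have hW := isOpen_forall_lie (cont_br S) _ (open_U S)
  obtain ⟨W, hWo, hWe⟩ := isOpen_induced_iff.1 hW
  have h0 : S.zero ∈ W := by
    have : (0 : S.X) ∈ Subtype.val ⁻¹' W := by
      rw [hWe]
      intro y
      rw [zero_lie]; rfl
    exact this
  obtain ⟨N, u, hu, hN⟩ := isOpen_pi_iff.1 hWo _ h0
  set E : Set G := ⋃ n ∈ N, (fun h => h * n⁻¹) '' {g : G | (d : G → A) g ≠ S.zero g} with hE
  have hEf : E.Finite := N.finite_toSet.biUnion fun n _ => hd.2.image _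
  have key : ∀ (y : S.X) (g : G), g ∉ E → (⁅d, y⁆ : S.X).1 g = S.zero g := by
    intro y g hg
    have hz : sh S g⁻¹ d ∈ Subtype.val ⁻¹' W := by
      apply hN
      intro n hn
      have : (sh S g⁻¹ d : G → A) n = S.zero n := by
        by_contra hne
        apply hg
        refine Set.mem_biUnion hn ⟨g * n, ?_, by simp⟩
        change (d : G → A) (g * n) ≠ S.zero (g * n)
        rw [zero_const, ← zero_const S n]
        simpa [sh, shiftMap] using hne
      rw [this]
      exact (hu n hn).2
    rw [hWe] at hz
    have := hz (sh S g⁻¹ y)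
    rw [← sh_br] at this
    change (sh S g⁻¹ ⁅d, y⁆ : G → A) 1 = S.zero 1 at this
    rw [sh_inv_one] at this
    rw [this, zero_const S g]
  have : Finite E := hEf
  let r : S.X → (E → A) := fun z e => z.1 e
  refine Set.Finite.of_finite_image (f := r) (Set.toFinite _) ?_
  rintro _ ⟨y, rfl⟩ _ ⟨y', rfl⟩ h
  apply Subtype.ext
  funext g
  by_cases hg : g ∈ E
  · exact congrFun h ⟨g, hg⟩
  · exact (key y g hg).trans (key y' g hg).symm

end Concrete

end LieCell

open LieCell in
/-- If `G` is finitely generated, `K` a finite field, and `X ⊆ A^G`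
a Lie algebraic `G`-subshift over `K` whose homoclinic group `Δ_X` is dense in `X` and
finitely orbit-generated as a subgroup of `(X, +)`, then `X` is cellwiseable. -/
theorem lie_subshift_cellwiseable_of_dense_fog_homoclinic
    (K : Type) [Field K] [Fintype K]
    (G : Type) [Group G] (hFG : Group.FG G)
    (A : Type) [Fintype A] [TopologicalSpace A] [DiscreteTopology A]
    (S : LieAlgSubshift K G A)
    (hdense : S.X ⊆ closure S.delta)
    (hfog : S.FinitelyOrbitGenerated S.delta) :
    S.Cellwiseable := by
  classical
  obtain ⟨V, hVo, hVU⟩ := exists_open_submodule (K := K) (cont_smul S) _ (open_U S) rfl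
  have hD : Dense {x : S.X | (x : G → A) ∈ S.delta} := by
    intro x
    rw [closure_subtype]
    convert hdense x.2 using 2
    ext z
    constructor
    · rintro ⟨w, hw, rfl⟩; exact hw
    · intro hz; exact ⟨⟨z, hz.1⟩, hz, rfl⟩
  obtain ⟨I, hIo, hIV⟩ := exists_open_ideal (cont_br S) _ hD
    (fun d hd => finite_range_br S d hd) V hVo
  have hIU : ∀ x ∈ I, (x : G → A) 1 = S.zero 1 := fun x hx => hVU (hIV x hx)
  let mk : S.X → S.X ⧸ I := LieSubmodule.Quotient.mk
  have hmk : ∀ x y, mk x = mk y ↔ x - y ∈ I := fun x y => Submodule.Quotient.eq _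
  let tB : TopologicalSpace (S.X ⧸ I) := ⊥
  have dB : @DiscreteTopology (S.X ⧸ I) tB := ⟨rfl⟩
  have hmkc : @Continuous _ _ _ tB mk := by
    rw [continuous_discrete_rng]
    intro b
    obtain ⟨x, rfl⟩ : ∃ x, mk x = b := Submodule.Quotient.mk_surjective _ b
    have : mk ⁻¹' {mk x} = (fun y => y - x) ⁻¹' (I : Set S.X) := by
      ext y
      exact hmk y x
    rw [this]
    exact hIo.preimage (continuous_id.sub continuous_const)
  have hmks : Function.Surjective mk := Submodule.Quotient.mk_surjective _
  have fB : Finite (S.X ⧸ I) := by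
    have : CompactSpace (S.X ⧸ I) := hmks.compactSpace hmkc
    exact finite_of_compact_of_discrete
  let Φ : S.X → G → S.X ⧸ I := fun x g => mk (sh S g⁻¹ x)
  have hΦc : Continuous Φ := continuous_pi fun g => hmkc.comp (cont_sh S g⁻¹)
  have hΦi : Function.Injective Φ := by
    intro x y h
    rw [← sub_eq_zero]
    apply Subtype.ext
    funext g
    have h1 := (hmk _ _).1 (congrFun h g)
    rw [sub_eq_add_neg, ← sh_neg, ← sh_add, ← sub_eq_add_neg] at h1
    have h2 := hIU _ h1
    rw [sh_inv_one] at h2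
    rw [h2, ← zero_const S g]
    rfl
  have hΦe := hΦc.isClosedEmbedding hΦi
  have hΦadd : ∀ x y, Φ (x + y) = fun h => Φ x h + Φ y h := by
    intro x y; funext h; simp only [Φ, sh_add]; rfl
  have hΦneg : ∀ x, Φ (-x) = fun h => -Φ x h := by
    intro x; funext h; simp only [Φ, sh_neg]; rfl
  have hΦsmul : ∀ (c : K) x, Φ (c • x) = fun h => c • Φ x h := by
    intro c x; funext h; simp only [Φ, sh_smul]; rfl
  have hΦbr : ∀ x y, Φ ⁅x, y⁆ = fun h => ⁅Φ x h, Φ y h⁆ := by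
    intro x y; funext h; simp only [Φ, sh_br]; rfl
  have hΦzero : Φ 0 = fun _ => 0 := by
    funext h; simp only [Φ, sh_zero]; rfl
  have hΦsh : ∀ g x, Φ (sh S g x) = shiftMap g (Φ x) := by
    intro g x; funext h
    simp only [Φ, shiftMap]
    congr 1
    apply Subtype.ext
    funext k
    simp [sh, shiftMap, mul_assoc]
  let C : CellwiseLieSubshift K G :=
    { B := S.X ⧸ I
      fintypeB := Fintype.ofFinite _
      topB := tB
      discreteB := dB
      Y := Set.range Φ
      closed := hΦe.isClosed_range
      shift_mem := by rintro g _ ⟨x, rfl⟩; exact ⟨_, hΦsh g x⟩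
      zero_mem := ⟨0, hΦzero⟩
      add_mem := by rintro _ ⟨x, rfl⟩ _ ⟨y, rfl⟩; exact ⟨_, hΦadd x y⟩
      neg_mem := by rintro _ ⟨x, rfl⟩; exact ⟨_, hΦneg x⟩
      smul_mem := by rintro c _ ⟨x, rfl⟩; exact ⟨_, hΦsmul c x⟩
      br_mem := by rintro _ ⟨x, rfl⟩ _ ⟨y, rfl⟩; exact ⟨_, hΦbr x y⟩ }
  let φ : (G → A) → (G → S.X ⧸ I) := fun x => if h : x ∈ S.X then Φ ⟨x, h⟩ else fun _ => 0
  have hφ : ∀ x (h : x ∈ S.X), φ x = Φ ⟨x, h⟩ := fun x h => dif_pos h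
  let ψ : (G → S.X ⧸ I) → (G → A) := fun y => (Function.invFun Φ y : S.X)
  have hψ : ∀ x : S.X, ψ (Φ x) = x := fun x =>
    congrArg Subtype.val (Function.leftInverse_invFun hΦi x)
  have hinj : Set.LeftInvOn ψ φ S.X := by
    intro x hx
    rw [hφ x hx, hψ]
  refine ⟨C, φ, ψ, ⟨?_, hinj.injOn, ?_⟩, ?_, ⟨hinj, ?_⟩, ?_, ?_, ?_, ?_, ?_, ?_, ?_⟩
  · intro x hx; rw [hφ x hx]; exact ⟨_, rfl⟩
  · rintro _ ⟨x, rfl⟩; exact ⟨x, x.2, hφ _ x.2⟩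
  · rw [continuousOn_iff_continuous_domRestrict]
    convert hΦc using 1
    funext x
    exact hφ _ x.2
  · rintro _ ⟨x, rfl⟩
    rw [hψ, hφ _ x.2]
  · rw [continuousOn_iff_continuous_domRestrict]
    have hc : Continuous (fun y : Set.range Φ =>
        ((hΦe.isEmbedding.toHomeomorph.symm y : S.X) : G → A)) :=
      continuous_subtype_val.comp hΦe.isEmbedding.toHomeomorph.symm.continuous
    convert hc using 1
    funext y
    obtain ⟨x, rfl⟩ := hΦe.isEmbedding.toHomeomorph.surjective y
    rw [Homeomorph.symm_apply_apply]
    exact hψ x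
  · intro g x hx
    rw [hφ x hx, hφ _ (S.shift_mem g x hx)]
    exact hΦsh g ⟨x, hx⟩
  · rw [hφ _ S.zero_mem]; exact hΦzero
  · intro x hx y hy
    rw [hφ x hx, hφ y hy, hφ _ (S.add_mem x hx y hy)]
    exact hΦadd ⟨x, hx⟩ ⟨y, hy⟩
  · intro x hx
    rw [hφ x hx, hφ _ (S.neg_mem x hx)]
    exact hΦneg ⟨x, hx⟩
  · intro c x hx
    rw [hφ x hx, hφ _ (S.smul_mem c x hx)]
    exact hΦsmul c ⟨x, hx⟩
  · intro x hx y hy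
    rw [hφ x hx, hφ y hy, hφ _ (S.br_mem x hx y hy)]
    exact hΦbr ⟨x, hx⟩ ⟨y, hy⟩
end

section
/- Let G be a virtually polycyclic group (i.e., G has a finite-index subgroup H that is solvable and all of whose subgroups are finitely generated), K a finite field, A a finite set, and X ⊆ A^G a Lie algebraic G-subshift over K. If the homoclinic group Δ_X is dense in X, then X is cellwiseable. -/
/-- `G` is virtually polycyclic: it has a finite-index subgroup that is solvable and
all of whose subgroups are finitely generated. -/
def VirtuallyPolycyclic (G : Type) [Group G] : Prop :=
  ∃ H : Subgroup G, H.FiniteIndex ∧ IsSolvable H ∧ ∀ H' : Subgroup H, Group.FG H'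

/-! ### Open ideals in compact Lie algebras with a dense set of elements with open centralizer -/

theorem exists_open_subspace_aux {K L : Type} [Field K] [Finite K] [AddCommGroup L] [Module K L]
    [TopologicalSpace L] [CompactSpace L] [T2Space L] [TotallyDisconnectedSpace L]
    [IsTopologicalAddGroup L]
    (hsm : ∀ c : K, Continuous (fun x : L => c • x))
    (O : Set L) (hO : IsOpen O) (h0 : (0 : L) ∈ O) :
    ∃ U : Submodule K L, IsOpen (U : Set L) ∧ (U : Set L) ⊆ O := by
  obtain ⟨W, hW, hWO⟩ := (nhds_basis_clopen (0 : L)).mem_iff.mp (hO.mem_nhds h0)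
  obtain ⟨H, hH⟩ := IsTopologicalAddGroup.exist_openAddSubgroup_sub_clopen_nhds_of_zero hW.2 hW.1
  refine ⟨{ carrier := {x | ∀ c : K, c • x ∈ H}
            add_mem' := ?_
            zero_mem' := ?_
            smul_mem' := ?_ }, ?_, ?_⟩
  · intro a b ha hb c
    rw [smul_add]
    exact H.add_mem (ha c) (hb c)
  · intro c
    rw [smul_zero]
    exact H.zero_mem
  · intro d x hx c
    rw [smul_smul]
    exact hx _
  · change IsOpen {x : L | ∀ c : K, c • x ∈ H}
    rw [Set.ofPred_forall]
    exact isOpen_iInter_of_finite fun c => H.isOpen.preimage (hsm c)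
  · intro x hx
    have := hx 1
    rw [one_smul] at this
    exact hWO (hH this)

theorem exists_open_ideal_aux {K L : Type} [Field K] [Finite K] [LieRing L] [LieAlgebra K L]
    [TopologicalSpace L] [CompactSpace L] [T2Space L] [TotallyDisconnectedSpace L]
    [IsTopologicalAddGroup L]
    (hsm : ∀ c : K, Continuous (fun x : L => c • x))
    (hbr : Continuous (fun p : L × L => ⁅p.1, p.2⁆))
    (D : Set L) (hD : Dense D) (hc : ∀ m ∈ D, IsOpen {y : L | ⁅m, y⁆ = 0})
    (O : Set L) (hO : IsOpen O) (h0 : (0 : L) ∈ O) :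
    ∃ I : LieIdeal K L, IsOpen (I : Set L) ∧ (I : Set L) ⊆ O := by
  obtain ⟨U, hU, hUO⟩ := exists_open_subspace_aux hsm O hO h0
  -- `P` : elements `x` with `[x, L] ⊆ U`; contains a neighbourhood of `0`
  have hP : ∀ᶠ x in nhds (0 : L), ∀ y ∈ (Set.univ : Set L), ⁅x, y⁆ ∈ U := by
    refine isCompact_univ.eventually_forall_of_forall_eventually fun y _ => ?_
    refine (hU.preimage hbr).mem_nhds ?_
    change ⁅(0 : L), y⁆ ∈ U
    rw [zero_lie]
    exact U.zero_mem
  obtain ⟨P, hPs, hPo, hP0⟩ := eventually_nhds_iff.mp hP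
  -- finitely many elements of `D` such that every `x` is in `m + P`
  obtain ⟨M, hM⟩ := isCompact_univ.elim_finite_subcover
    (fun m : D => {x : L | x - m.1 ∈ P})
    (fun m => hPo.preimage (continuous_id.sub continuous_const)) (by
      intro x _
      have hx : IsOpen {d : L | x - d ∈ P} := hPo.preimage (continuous_const.sub continuous_id)
      obtain ⟨d, hd, hdD⟩ := hD.inter_open_nonempty _ hx ⟨x, by simpa using hP0⟩
      exact Set.mem_iUnion.mpr ⟨⟨d, hdD⟩, hd⟩)
  let ad : List M → L → L := fun l y => l.foldl (fun z m => ⁅(m.1.1 : L), z⁆) y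
  have ad_cons : ∀ m l y, ad (m :: l) y = ad l ⁅(m.1.1 : L), y⁆ := fun m l y => rfl
  have ad_add : ∀ l y z, ad l (y + z) = ad l y + ad l z := by
    intro l
    induction l with
    | nil => intro y z; rfl
    | cons m l ih => intro y z; rw [ad_cons, ad_cons, ad_cons, lie_add, ih]
  have ad_smul : ∀ l (c : K) y, ad l (c • y) = c • ad l y := by
    intro l
    induction l with
    | nil => intro c y; rfl
    | cons m l ih => intro c y; rw [ad_cons, ad_cons, lie_smul, ih]
  have ad_zero : ∀ l, ad l 0 = 0 := by
    intro l
    have := ad_smul l 0 0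
    simpa using this
  have key : ∀ (l : List M) (x y : L), (∀ l', ad l' y ∈ U) → ad l ⁅x, y⁆ ∈ U := by
    intro l
    induction l with
    | nil =>
      intro x y hy
      change ⁅x, y⁆ ∈ U
      obtain ⟨m, hm, hx⟩ := Set.mem_iUnion₂.mp (hM (Set.mem_univ x))
      have h1 : ⁅x, y⁆ = ⁅x - m.1, y⁆ + ⁅m.1, y⁆ := by
        rw [← add_lie, sub_add_cancel]
      rw [h1]
      exact U.add_mem (hPs _ hx y (Set.mem_univ y)) (hy [⟨m, hm⟩])
    | cons m l ih =>
      intro x y hy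
      rw [ad_cons, leibniz_lie, ad_add]
      exact U.add_mem (ih _ _ hy) (ih _ _ fun l' => hy (m :: l'))
  let I : LieIdeal K L :=
    { carrier := {y | ∀ l, ad l y ∈ U}
      add_mem' := fun {a b} ha hb l => by rw [ad_add]; exact U.add_mem (ha l) (hb l)
      zero_mem' := fun l => by rw [ad_zero]; exact U.zero_mem
      smul_mem' := fun c x hx l => by rw [ad_smul]; exact U.smul_mem c (hx l)
      lie_mem := fun {x y} hy l => key l x y hy }
  refine ⟨I, ?_, fun y hy => hUO (hy [])⟩
  have hQ : IsOpen ((U : Set L) ∩ ⋂ m : M, {y : L | ⁅m.1.1, y⁆ = 0}) :=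
    hU.inter (isOpen_iInter_of_finite fun m => hc _ m.1.2)
  have hsub : ((U : Set L) ∩ ⋂ m : M, {y : L | ⁅m.1.1, y⁆ = 0}) ⊆ (I : Set L) := by
    rintro y ⟨hyU, hy⟩ l
    cases l with
    | nil => exact hyU
    | cons m l =>
      have : ⁅m.1.1, y⁆ = 0 := Set.mem_iInter.mp hy m
      rw [ad_cons, this, ad_zero]
      exact U.zero_mem
  refine I.toSubmodule.toAddSubgroup.isOpen_of_mem_nhds (g := 0) ?_
  refine Filter.mem_of_superset (hQ.mem_nhds ⟨U.zero_mem, ?_⟩) hsub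
  simp

/-! ### The points of a Lie algebraic subshift as a Lie algebra -/

namespace LieAlgSubshift

section points

variable {K : Type} [Field K] {G : Type} [Group G] {A : Type} [TopologicalSpace A]

/-- The type of points of the subshift. -/
def Pt (S : LieAlgSubshift K G A) : Type := S.X

instance (S : LieAlgSubshift K G A) : TopologicalSpace S.Pt :=
  inferInstanceAs (TopologicalSpace S.X)

theorem Pt.ext {S : LieAlgSubshift K G A} {x y : S.Pt} (h : x.1 = y.1) : x = y := Subtype.ext h

instance (S : LieAlgSubshift K G A) : Zero S.Pt := ⟨⟨S.zero, S.zero_mem⟩⟩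

instance (S : LieAlgSubshift K G A) : Add S.Pt :=
  ⟨fun x y => ⟨S.add x.1 y.1, S.add_mem _ x.2 _ y.2⟩⟩

instance (S : LieAlgSubshift K G A) : Neg S.Pt := ⟨fun x => ⟨S.neg x.1, S.neg_mem _ x.2⟩⟩

instance (S : LieAlgSubshift K G A) : AddCommGroup S.Pt where
  add_assoc x y z := Pt.ext (S.add_assoc' _ x.2 _ y.2 _ z.2)
  zero_add x := Pt.ext (S.zero_add' _ x.2)
  add_zero x := Pt.ext ((S.add_comm' _ x.2 _ S.zero_mem).trans (S.zero_add' _ x.2))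
  neg_add_cancel x := Pt.ext (S.neg_add' _ x.2)
  add_comm x y := Pt.ext (S.add_comm' _ x.2 _ y.2)
  nsmul := nsmulRec
  zsmul := zsmulRec

instance (S : LieAlgSubshift K G A) : Module K S.Pt where
  smul c x := ⟨S.smul c x.1, S.smul_mem c _ x.2⟩
  one_smul x := Pt.ext (S.one_smul' _ x.2)
  mul_smul a b x := Pt.ext (S.mul_smul' a b _ x.2)
  smul_add a x y := Pt.ext (S.smul_add' a _ x.2 _ y.2)
  add_smul a b x := Pt.ext (S.add_smul' a b _ x.2)
  zero_smul x := Pt.ext (S.zero_smul' _ x.2)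
  smul_zero a := by
    apply Pt.ext
    change S.smul a S.zero = S.zero
    have h := S.zero_smul' _ S.zero_mem
    calc S.smul a S.zero = S.smul a (S.smul 0 S.zero) := by rw [h]
      _ = S.smul (a * 0) S.zero := (S.mul_smul' a 0 _ S.zero_mem).symm
      _ = S.zero := by rw [mul_zero, h]

instance (S : LieAlgSubshift K G A) : Bracket S.Pt S.Pt where
  bracket x y := ⟨S.br x.1 y.1, S.br_mem _ x.2 _ y.2⟩

theorem Pt.lie_add_aux {S : LieAlgSubshift K G A} (x y z : S.Pt) :
    ⁅x, y + z⁆ = ⁅x, y⁆ + ⁅x, z⁆ := Pt.ext (S.br_add_right _ y.2 _ z.2 _ x.2)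

theorem Pt.add_lie_aux {S : LieAlgSubshift K G A} (x y z : S.Pt) :
    ⁅x + y, z⁆ = ⁅x, z⁆ + ⁅y, z⁆ := Pt.ext (S.br_add_left _ x.2 _ y.2 _ z.2)

theorem Pt.lie_self_aux {S : LieAlgSubshift K G A} (x : S.Pt) : ⁅x, x⁆ = 0 :=
  Pt.ext (S.br_self _ x.2)

theorem Pt.skew_aux {S : LieAlgSubshift K G A} (x y : S.Pt) : ⁅x, y⁆ = -⁅y, x⁆ := by
  have h := Pt.lie_self_aux (x + y)
  rw [Pt.lie_add_aux, Pt.add_lie_aux, Pt.add_lie_aux, Pt.lie_self_aux, Pt.lie_self_aux,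
    zero_add, add_zero] at h
  exact eq_neg_of_add_eq_zero_right h

theorem Pt.neg_lie_aux {S : LieAlgSubshift K G A} (x y : S.Pt) : ⁅-x, y⁆ = -⁅x, y⁆ := by
  have h0 : ⁅(0 : S.Pt), y⁆ = 0 := by
    have := Pt.add_lie_aux (0 : S.Pt) 0 y
    rw [add_zero] at this
    exact left_eq_add.mp this
  have h := Pt.add_lie_aux (-x) x y
  rw [neg_add_cancel, h0] at h
  exact eq_neg_of_add_eq_zero_left h.symm

theorem Pt.jacobi_aux {S : LieAlgSubshift K G A} (x y z : S.Pt) :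
    ⁅⁅x, y⁆, z⁆ + (⁅⁅y, z⁆, x⁆ + ⁅⁅z, x⁆, y⁆) = 0 :=
  Pt.ext (S.jacobi _ x.2 _ y.2 _ z.2)

instance (S : LieAlgSubshift K G A) : LieRing S.Pt where
  add_lie := Pt.add_lie_aux
  lie_add := Pt.lie_add_aux
  lie_self := Pt.lie_self_aux
  leibniz_lie x y z := by
    have h := Pt.jacobi_aux x y z
    rw [Pt.skew_aux ⁅y, z⁆ x, Pt.skew_aux z x, Pt.neg_lie_aux, Pt.skew_aux ⁅x, z⁆ y, neg_neg] at h
    have h2 : ⁅⁅x, y⁆, z⁆ + ⁅y, ⁅x, z⁆⁆ - ⁅x, ⁅y, z⁆⁆ = 0 := by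
      rw [← h]; abel
    exact (sub_eq_zero.mp h2).symm

instance (S : LieAlgSubshift K G A) : LieAlgebra K S.Pt where
  lie_smul a x y := Pt.ext (S.br_smul_right a _ x.2 _ y.2)

/-- The shift action on points. -/
def Pt.shift {S : LieAlgSubshift K G A} (g : G) (x : S.Pt) : S.Pt :=
  ⟨shiftMap g x.1, S.shift_mem g _ x.2⟩

theorem Pt.continuous_shift {S : LieAlgSubshift K G A} (g : G) :
    Continuous (Pt.shift g : S.Pt → S.Pt) := by
  refine Continuous.subtype_mk (continuous_pi fun h => ?_) _
  exact (continuous_apply (g⁻¹ * h)).comp continuous_subtype_val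

theorem Pt.continuous_lie {S : LieAlgSubshift K G A} :
    Continuous (fun p : S.Pt × S.Pt => ⁅p.1, p.2⁆) := by
  refine Continuous.subtype_mk ?_ _
  exact S.br_contOn.comp_continuous
    ((continuous_subtype_val.comp continuous_fst).prodMk
      (continuous_subtype_val.comp continuous_snd)) fun p => ⟨p.1.2, p.2.2⟩

theorem Pt.continuous_smul {S : LieAlgSubshift K G A} (c : K) :
    Continuous (fun x : S.Pt => c • x) := by
  refine Continuous.subtype_mk ?_ _
  exact (S.smul_contOn c).comp_continuous continuous_subtype_val fun p => p.2

instance (S : LieAlgSubshift K G A) : IsTopologicalAddGroup S.Pt where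
  continuous_add := by
    refine Continuous.subtype_mk ?_ _
    exact S.add_contOn.comp_continuous
      ((continuous_subtype_val.comp continuous_fst).prodMk
        (continuous_subtype_val.comp continuous_snd)) fun p => ⟨p.1.2, p.2.2⟩
  continuous_neg := by
    refine Continuous.subtype_mk ?_ _
    exact S.neg_contOn.comp_continuous continuous_subtype_val fun p => p.2

instance (S : LieAlgSubshift K G A) [T2Space A] : T2Space S.Pt :=
  inferInstanceAs (T2Space S.X)

instance (S : LieAlgSubshift K G A) [DiscreteTopology A] : TotallyDisconnectedSpace S.Pt :=
  inferInstanceAs (TotallyDisconnectedSpace S.X)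

instance (S : LieAlgSubshift K G A) [Finite A] : CompactSpace S.Pt :=
  isCompact_iff_compactSpace.mp S.closed.isCompact

theorem Pt.isOpen_coord {S : LieAlgSubshift K G A} [DiscreteTopology A] (g : G) :
    IsOpen {x : S.Pt | x.1 g = S.zero g} := by
  have h : Continuous (fun x : S.Pt => x.1 g) :=
    (continuous_apply g).comp continuous_subtype_val
  exact (isOpen_discrete {S.zero g}).preimage h

/-- Homoclinic points have open centralizer. -/
theorem Pt.isOpen_centralizer {S : LieAlgSubshift K G A} [Finite A] [DiscreteTopology A]
    (m : S.Pt) (hm : {g : G | m.1 g ≠ S.zero g}.Finite) : IsOpen {y : S.Pt | ⁅m, y⁆ = 0} := by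
  have hN : ∀ᶠ x in nhds (0 : S.Pt), ∀ y ∈ (Set.univ : Set S.Pt), (⁅x, y⁆).1 1 = S.zero 1 := by
    refine isCompact_univ.eventually_forall_of_forall_eventually fun y _ => ?_
    refine ((Pt.isOpen_coord (S := S) 1).preimage Pt.continuous_lie).mem_nhds ?_
    change (⁅(0 : S.Pt), y⁆).1 1 = S.zero 1
    rw [zero_lie]
    rfl
  -- a finite window
  obtain ⟨T, hT⟩ : ∃ T : Finset G, ∀ x : S.Pt, (∀ t ∈ T, x.1 t = S.zero t) →
      ∀ y : S.Pt, (⁅x, y⁆).1 1 = S.zero 1 := by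
    obtain ⟨W, hW, hWs⟩ := mem_nhds_induced (Subtype.val : S.X → G → A) (0 : S.Pt) _ |>.mp hN
    rw [nhds_pi] at hW
    obtain ⟨J, hJ, t, ht, hts⟩ := Filter.mem_pi.mp hW
    refine ⟨hJ.toFinset, fun x hx y => hWs (a := x) (hts fun i hi => ?_) y (Set.mem_univ y)⟩
    change x.1 i ∈ t i
    rw [hx i (hJ.mem_toFinset.mpr hi)]
    exact mem_of_mem_nhds (ht i)
  have shift_zero : ∀ g h : G, S.zero (g * h) = S.zero h := by
    intro g h
    have := congrFun (S.zero_shift g⁻¹) h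
    simpa [shiftMap] using this
  have hfin : {g : G | ∃ t ∈ T, m.1 (g * t) ≠ S.zero (g * t)}.Finite := by
    have : {g : G | ∃ t ∈ T, m.1 (g * t) ≠ S.zero (g * t)} =
        ⋃ t ∈ T, (fun g => g * t) ⁻¹' {g : G | m.1 g ≠ S.zero g} := by
      ext g; simp
    rw [this]
    exact T.finite_toSet.biUnion fun t _ => hm.preimage ((mul_left_injective t).injOn)
  have hset : {y : S.Pt | ⁅m, y⁆ = 0} =
      ⋂ g ∈ {g : G | ∃ t ∈ T, m.1 (g * t) ≠ S.zero (g * t)},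
        {y : S.Pt | (⁅m, y⁆).1 g = S.zero g} := by
    ext y
    simp only [Set.mem_iInter]
    constructor
    · intro hy g _
      change (⁅m, y⁆).1 g = S.zero g
      rw [show ⁅m, y⁆ = 0 from hy]
      rfl
    · intro hy
      apply Pt.ext
      funext g
      change (⁅m, y⁆).1 g = S.zero g
      by_cases hg : ∃ t ∈ T, m.1 (g * t) ≠ S.zero (g * t)
      · exact hy g hg
      · push Not at hg
        have h1 := hT (Pt.shift g⁻¹ m) (fun t ht => by
          have := hg t ht
          rw [shift_zero] at this
          simpa [Pt.shift, shiftMap] using this) (Pt.shift g⁻¹ y)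
        have h2 : (⁅Pt.shift g⁻¹ m, Pt.shift g⁻¹ y⁆).1 = shiftMap g⁻¹ (⁅m, y⁆).1 :=
          (S.br_shift g⁻¹ _ m.2 _ y.2).symm
        rw [h2] at h1
        have h3 := shift_zero g 1
        rw [mul_one] at h3
        rw [h3]
        simpa [shiftMap] using h1
  rw [hset]
  refine hfin.isOpen_biInter fun g _ => ?_
  exact (Pt.isOpen_coord (S := S) g).preimage
    (Pt.continuous_lie.comp (continuous_const.prodMk continuous_id))

/-- There is an open ideal all of whose points vanish at the identity. -/
theorem exists_open_ideal [Finite K] [Finite A] [DiscreteTopology A] (S : LieAlgSubshift K G A)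
    (hdense : S.X ⊆ closure S.delta) :
    ∃ I : LieIdeal K S.Pt, IsOpen (I : Set S.Pt) ∧ ∀ x ∈ I, x.1 1 = S.zero 1 := by
  obtain ⟨I, hI, hI'⟩ := exists_open_ideal_aux (K := K) (L := S.Pt) Pt.continuous_smul
    Pt.continuous_lie {x | {g : G | x.1 g ≠ S.zero g}.Finite} (by
      intro x
      refine (closure_subtype (X := G → A) (p := fun z => z ∈ S.X) (x := x)).mpr ?_
      refine closure_mono ?_ (hdense x.2)
      intro z hz
      exact ⟨⟨z, hz.1⟩, hz.2, rfl⟩)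
    (fun m hm => Pt.isOpen_centralizer m hm) _ (Pt.isOpen_coord (S := S) 1) rfl
  exact ⟨I, hI, fun x hx => hI' hx⟩

theorem cellwiseable_of_open_ideal [Finite A] [DiscreteTopology A] (S : LieAlgSubshift K G A)
    (I : LieIdeal K S.Pt) (hI : IsOpen (I : Set S.Pt)) (hI1 : ∀ x ∈ I, x.1 1 = S.zero 1) :
    S.Cellwiseable := by
  classical
  have hopen : IsOpen (I.toSubmodule.toAddSubgroup : Set S.Pt) := hI
  have hfin : Finite (S.Pt ⧸ I) :=
    AddSubgroup.quotient_finite_of_isOpen I.toSubmodule.toAddSubgroup hopen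
  let _ : Fintype (S.Pt ⧸ I) := Fintype.ofFinite _
  let _ : TopologicalSpace (S.Pt ⧸ I) := ⊥
  have _ : DiscreteTopology (S.Pt ⧸ I) := ⟨rfl⟩
  let q : S.Pt → S.Pt ⧸ I := LieSubmodule.Quotient.mk
  have hq0 : ∀ x, q x = 0 ↔ x ∈ I := fun x => LieSubmodule.Quotient.mk_eq_zero'
  have hqadd : ∀ x y, q (x + y) = q x + q y := fun x y => rfl
  have hqneg : ∀ x, q (-x) = - q x := fun x => rfl
  have hqsub : ∀ x y, q (x - y) = q x - q y := fun x y => rfl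
  have hqsmul : ∀ (c : K) x, q (c • x) = c • q x := fun c x => rfl
  have hqlie : ∀ x y, q ⁅x, y⁆ = ⁅q x, q y⁆ := fun x y => rfl
  have hqc : Continuous q := by
    refine continuous_discrete_rng.mpr fun b => ?_
    obtain ⟨a, rfl⟩ := Submodule.Quotient.mk_surjective _ b
    have : q ⁻¹' {q a} = (fun x => x - a) ⁻¹' (I : Set S.Pt) := by
      ext x
      change q x = q a ↔ x - a ∈ I
      rw [← hq0, hqsub, sub_eq_zero]
    exact this ▸ hI.preimage (continuous_id.sub continuous_const)
  let Φ : S.Pt → G → S.Pt ⧸ I := fun x g => q (Pt.shift g⁻¹ x)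
  have hΦc : Continuous Φ := continuous_pi fun g => hqc.comp (Pt.continuous_shift _)
  have hΦadd : ∀ x y, Φ (x + y) = fun h => Φ x h + Φ y h := by
    intro x y
    funext h
    change q (Pt.shift h⁻¹ (x + y)) = q (Pt.shift h⁻¹ x + Pt.shift h⁻¹ y)
    exact congrArg q (Pt.ext (S.add_shift _ _ x.2 _ y.2))
  have hΦneg : ∀ x, Φ (-x) = fun h => - Φ x h := by
    intro x
    funext h
    change q (Pt.shift h⁻¹ (-x)) = q (- Pt.shift h⁻¹ x)
    exact congrArg q (Pt.ext (S.neg_shift _ _ x.2))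
  have hΦsmul : ∀ (c : K) x, Φ (c • x) = fun h => c • Φ x h := by
    intro c x
    funext h
    change q (Pt.shift h⁻¹ (c • x)) = q (c • Pt.shift h⁻¹ x)
    exact congrArg q (Pt.ext (S.smul_shift _ _ _ x.2))
  have hΦlie : ∀ x y, Φ ⁅x, y⁆ = fun h => ⁅Φ x h, Φ y h⁆ := by
    intro x y
    funext h
    change q (Pt.shift h⁻¹ ⁅x, y⁆) = q ⁅Pt.shift h⁻¹ x, Pt.shift h⁻¹ y⁆
    exact congrArg q (Pt.ext (S.br_shift _ _ x.2 _ y.2))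
  have hΦ0 : Φ 0 = fun _ => 0 := by
    funext h
    change q (Pt.shift h⁻¹ 0) = q 0
    exact congrArg q (Pt.ext (S.zero_shift _))
  have hΦshift : ∀ g x, Φ (Pt.shift g x) = shiftMap g (Φ x) := by
    intro g x
    funext h
    refine congrArg q (Pt.ext ?_)
    funext k
    simp [Pt.shift, shiftMap, mul_assoc]
  have hker : ∀ x, Φ x = (fun _ => 0) → x = 0 := by
    intro x hx
    apply Pt.ext
    funext g
    have h1 := hI1 _ ((hq0 _).mp (congrFun hx g))
    have h2 : S.zero 1 = S.zero g := by
      have := congrFun (S.zero_shift g) g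
      simpa [shiftMap] using this
    rw [h2] at h1
    change x.1 g = S.zero g
    simpa [Pt.shift, shiftMap] using h1
  have hinj : Function.Injective Φ := by
    intro x y hxy
    refine sub_eq_zero.mp (hker _ ?_)
    rw [sub_eq_add_neg, hΦadd, hΦneg, hxy]
    funext h
    exact add_neg_cancel _
  have hemb : Topology.IsClosedEmbedding Φ := hΦc.isClosedEmbedding hinj
  let e := hemb.isEmbedding.toHomeomorph
  let C : CellwiseLieSubshift K G :=
    { B := S.Pt ⧸ I
      discreteB := inferInstance
      Y := Set.range Φ
      closed := hemb.isClosed_range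
      shift_mem := by
        rintro g _ ⟨x, rfl⟩
        exact ⟨_, hΦshift g x⟩
      zero_mem := ⟨0, hΦ0⟩
      add_mem := by
        rintro _ ⟨x, rfl⟩ _ ⟨y, rfl⟩
        exact ⟨_, hΦadd x y⟩
      neg_mem := by
        rintro _ ⟨x, rfl⟩
        exact ⟨_, hΦneg x⟩
      smul_mem := by
        rintro c _ ⟨x, rfl⟩
        exact ⟨_, hΦsmul c x⟩
      br_mem := by
        rintro _ ⟨x, rfl⟩ _ ⟨y, rfl⟩
        exact ⟨_, hΦlie x y⟩ }
  let φ : (G → A) → (G → S.Pt ⧸ I) := fun x => if hx : x ∈ S.X then Φ ⟨x, hx⟩ else fun _ => 0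
  let ψ : (G → S.Pt ⧸ I) → (G → A) :=
    fun y => if hy : y ∈ Set.range Φ then (e.symm ⟨y, hy⟩).1 else S.zero
  have hφ : ∀ x : S.Pt, φ x.1 = Φ x := fun x => dif_pos x.2
  have hψ : ∀ x : S.Pt, ψ (Φ x) = x.1 := by
    intro x
    have h1 : ψ (Φ x) = (e.symm ⟨Φ x, x, rfl⟩).1 := dif_pos ⟨x, rfl⟩
    rw [h1]
    exact congrArg Subtype.val (e.symm_apply_apply x)
  have hinv : Set.InvOn ψ φ S.X (Set.range Φ) := by
    constructor
    · intro x hx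
      have := hφ ⟨x, hx⟩
      change φ x = _ at this
      rw [this]
      exact hψ _
    · rintro _ ⟨x, rfl⟩
      rw [hψ, hφ]
  refine ⟨C, φ, ψ, hinv.bijOn ?_ ?_, ?_, hinv, ?_, ?_, ?_, ?_, ?_, ?_, ?_⟩
  · intro x hx
    exact ⟨⟨x, hx⟩, (hφ ⟨x, hx⟩).symm⟩
  · rintro _ ⟨x, rfl⟩
    rw [hψ]
    exact x.2
  · rw [continuousOn_iff_continuous_domRestrict]
    have : S.X.domRestrict φ = Φ := funext hφ
    rw [this]
    exact hΦc
  · rw [continuousOn_iff_continuous_domRestrict]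
    have : (Set.range Φ).domRestrict ψ = fun y => (e.symm y).1 := by
      funext y
      exact dif_pos y.2
    change Continuous ((Set.range Φ).domRestrict ψ)
    rw [this]
    exact continuous_subtype_val.comp e.symm.continuous
  · intro g x hx
    have h1 := hφ ⟨x, hx⟩
    have h2 := hφ (Pt.shift g ⟨x, hx⟩)
    exact h2.trans ((hΦshift g _).trans (congrArg _ h1.symm))
  · exact (hφ 0).trans hΦ0
  · intro x hx y hy
    have h1 : φ x = _ := hφ ⟨x, hx⟩
    have h2 : φ y = _ := hφ ⟨y, hy⟩
    rw [h1, h2]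
    exact (hφ (⟨x, hx⟩ + ⟨y, hy⟩)).trans (hΦadd _ _)
  · intro x hx
    have h1 : φ x = _ := hφ ⟨x, hx⟩
    rw [h1]
    exact (hφ (-⟨x, hx⟩)).trans (hΦneg _)
  · intro c x hx
    have h1 : φ x = _ := hφ ⟨x, hx⟩
    rw [h1]
    exact (hφ (c • ⟨x, hx⟩)).trans (hΦsmul _ _)
  · intro x hx y hy
    have h1 : φ x = _ := hφ ⟨x, hx⟩
    have h2 : φ y = _ := hφ ⟨y, hy⟩
    rw [h1, h2]
    let x' : S.Pt := ⟨x, hx⟩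
    let y' : S.Pt := ⟨y, hy⟩
    exact (hφ ⁅x', y'⁆).trans (hΦlie x' y')

end points

end LieAlgSubshift

/-- If `G` is virtually polycyclic, `K` a finite field, and `X ⊆ A^G`
a Lie algebraic `G`-subshift over `K` whose homoclinic group `Δ_X` is dense in `X`,
then `X` is cellwiseable. -/
theorem lie_subshift_cellwiseable_of_virtually_polycyclic
    (K : Type) [Field K] [Fintype K]
    (G : Type) [Group G] (hvp : VirtuallyPolycyclic G)
    (A : Type) [Fintype A] [TopologicalSpace A] [DiscreteTopology A]
    (S : LieAlgSubshift K G A)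
    (hdense : S.X ⊆ closure S.delta) :
    S.Cellwiseable := by
  obtain ⟨I, hI, hI1⟩ := S.exists_open_ideal hdense
  exact S.cellwiseable_of_open_ideal I hI hI1
end

section
/- Let G be a virtually polycyclic group (i.e., G has a finite-index subgroup H that is solvable and all of whose subgroups are finitely generated), A a finite group, and Y a G-shift-invariant subgroup of the direct product group A^G (with pointwise multiplication) all of whose elements have finite support, i.e., every y ∈ Y satisfies y_g = 1_A for all but finitely many g ∈ G. Then Y is finitely orbit-generated: there is a finite set F ⊆ Y such that Y is generated as a group by {g·y : g ∈ G, y ∈ F}. -/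
section Aux

open scoped commutatorElement

variable {G A : Type} [Group G] [Group A]

/-- shift as a homomorphism -/
def shHom (g : G) : (G → A) →* (G → A) where
  toFun := shiftMap g
  map_one' := rfl
  map_mul' _ _ := rfl

theorem shHom_apply (g : G) (x : G → A) (h : G) : shHom g x h = x (g⁻¹ * h) := rfl

theorem shHom_shHom (g h : G) (x : G → A) : shHom g (shHom h x) = shHom (g * h) x := by
  funext k
  simp [shHom_apply, mul_assoc]

theorem shHom_one (x : G → A) : shHom (1 : G) x = x := by
  funext k
  simp [shHom_apply]

/-- invariance under a subgroup -/
def InvUnder (K : Subgroup G) (Y : Subgroup (G → A)) : Prop :=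
  ∀ g ∈ K, ∀ y ∈ Y, shHom g y ∈ Y

/-- subgroup generated by translates -/
def GenBy (K : Subgroup G) (E : Set (G → A)) : Subgroup (G → A) :=
  Subgroup.closure {z | ∃ g ∈ K, ∃ y ∈ E, z = shHom g y}

theorem subset_genBy (K : Subgroup G) (E : Set (G → A)) : E ⊆ GenBy K E := fun y hy =>
  Subgroup.subset_closure ⟨1, K.one_mem, y, hy, (shHom_one y).symm⟩

theorem genBy_inv (K : Subgroup G) (E : Set (G → A)) : InvUnder K (GenBy K E) := by
  intro g hg
  suffices h : GenBy K E ≤ (GenBy K E).comap (shHom g) from fun y hy => h hy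
  refine (Subgroup.closure_le _).2 ?_
  rintro z ⟨k, hk, y, hy, rfl⟩
  refine Subgroup.subset_closure ⟨g * k, K.mul_mem hg hk, y, hy, ?_⟩
  rw [shHom_shHom]

theorem genBy_le {K : Subgroup G} {E : Set (G → A)} {Y : Subgroup (G → A)}
    (hY : InvUnder K Y) (hE : E ⊆ Y) : GenBy K E ≤ Y := by
  refine (Subgroup.closure_le _).2 ?_
  rintro z ⟨k, hk, y, hy, rfl⟩
  exact hY k hk y (hE hy)

/-- the Noetherian property for K-invariant subgroups -/
def NoethP (A : Type) [Group A] (K : Subgroup G) : Prop :=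
  ∀ F : Set G, F.Finite → ∀ Y : Subgroup (G → A), InvUnder K Y →
    (∀ y ∈ Y, {g : G | y g ≠ 1}.Finite) →
    (∀ y ∈ Y, ∀ g, y g ≠ 1 → ∃ k ∈ K, ∃ f ∈ F, g = k * f) →
    ∃ E : Set (G → A), E.Finite ∧ E ⊆ Y ∧ Y ≤ GenBy K E

theorem noethP_bot [Finite A] : NoethP (G := G) A ⊥ := by
  intro F hF Y _ _ hs
  refine ⟨Y, ?_, subset_rfl, subset_genBy _ _⟩
  have := hF.to_subtype
  refine Set.Finite.of_finite_image (f := fun (y : G → A) (f : F) => y f) (Set.toFinite _) ?_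
  intro y hy z hz h
  funext g
  by_cases hg : g ∈ F
  · exact congrFun h ⟨g, hg⟩
  · have key : ∀ y ∈ Y, y g = 1 := by
      intro y hy
      by_contra hne
      obtain ⟨k, hk, f, hf, rfl⟩ := hs y hy g hne
      rw [Subgroup.mem_bot] at hk
      subst hk
      exact hg (by simpa using hf)
    rw [key y hy, key z hz]

/-- the positions at levels `0..n` -/
def lev (K : Subgroup G) (t : G) (F : Set G) (n : ℕ) : Set G :=
  {g | ∃ i ≤ n, ∃ k ∈ K, ∃ f ∈ F, g = t ^ i * (k * f)}

/-- elements of `Y` supported in `S` -/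
def suppIn (Y : Subgroup (G → A)) (S : Set G) : Subgroup (G → A) where
  carrier := {y | y ∈ Y ∧ ∀ g, g ∉ S → y g = 1}
  one_mem' := ⟨Y.one_mem, fun _ _ => rfl⟩
  mul_mem' := by
    rintro a b ⟨ha, ha'⟩ ⟨hb, hb'⟩
    exact ⟨Y.mul_mem ha hb, fun g hg => by simp [ha' g hg, hb' g hg]⟩
  inv_mem' := by
    rintro a ⟨ha, ha'⟩
    exact ⟨Y.inv_mem ha, fun g hg => by simp [ha' g hg]⟩

theorem mem_suppIn {Y : Subgroup (G → A)} {S : Set G} {y : G → A} :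
    y ∈ suppIn Y S ↔ y ∈ Y ∧ ∀ g, g ∉ S → y g = 1 := Iff.rfl

open Classical in
/-- restriction -/
noncomputable def resHom (S : Set G) : (G → A) →* (G → A) where
  toFun y := fun g => if g ∈ S then y g else 1
  map_one' := by funext g; simp
  map_mul' x y := by funext g; by_cases h : g ∈ S <;> simp [h]

open Classical in
theorem resHom_apply (S : Set G) (y : G → A) (g : G) :
    resHom S y g = if g ∈ S then y g else 1 := rfl

theorem conj_pow_aux {K : Subgroup G} {t : G} (h : ∀ k ∈ K, t * k * t⁻¹ ∈ K) (n : ℕ) :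
    ∀ k ∈ K, t ^ n * k * (t ^ n)⁻¹ ∈ K := by
  induction n with
  | zero => intro k hk; simpa using hk
  | succ n ih =>
    intro k hk
    have := h _ (ih k hk)
    convert this using 1
    rw [pow_succ']
    group

theorem noethP_step {K K' : Subgroup G} {t : G} (hK : NoethP A K) (hle : K ≤ K') (ht : t ∈ K')
    (h1 : ∀ k ∈ K, t * k * t⁻¹ ∈ K) (h2 : ∀ k ∈ K, t⁻¹ * k * t ∈ K)
    (hgen : ∀ g ∈ K', ∃ n : ℤ, ∃ k ∈ K, g = t ^ n * k) : NoethP A K' := by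
  intro F hF Y hinv hfin hsupp
  have c1 := conj_pow_aux h1
  have c2 : ∀ n : ℕ, ∀ k ∈ K, (t ^ n)⁻¹ * k * (t ^ n) ∈ K := by
    intro n k hk
    have := conj_pow_aux (K := K) (t := t⁻¹) (by simpa using h2) n k hk
    simpa using this
  set X := lev K t F with hX
  have Xmono : ∀ {m n}, m ≤ n → X m ⊆ X n := by
    rintro m n hmn g ⟨i, hi, r⟩
    exact ⟨i, hi.trans hmn, r⟩
  have Xk : ∀ n, ∀ k ∈ K, ∀ g, k * g ∈ X n → g ∈ X n := by
    rintro n k hk g ⟨i, hi, l, hl, f, hf, h⟩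
    refine ⟨i, hi, (t ^ i)⁻¹ * k⁻¹ * t ^ i * l, K.mul_mem (c2 i _ (K.inv_mem hk)) hl, f, hf, ?_⟩
    rw [eq_inv_mul_of_mul_eq h]
    group
  have Xk' : ∀ n, ∀ k ∈ K, ∀ g, g ∈ X n → k * g ∈ X n := by
    intro n k hk g hg
    apply Xk n k⁻¹ (K.inv_mem hk)
    simpa using hg
  have Xt : ∀ m n g, g ∈ X n → t ^ m * g ∈ X (m + n) := by
    rintro m n g ⟨i, hi, l, hl, f, hf, rfl⟩
    refine ⟨m + i, by omega, l, hl, f, hf, ?_⟩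
    rw [pow_add]; group
  have Xs : ∀ n g, g ∈ X (n + 1) → g ∈ X n ∨ (t ^ (n + 1))⁻¹ * g ∈ X 0 := by
    rintro n g ⟨i, hi, l, hl, f, hf, rfl⟩
    rcases Nat.lt_or_ge n i with h | h
    · right
      obtain rfl : i = n + 1 := by omega
      exact ⟨0, le_rfl, l, hl, f, hf, by simp⟩
    · left
      exact ⟨i, h, l, hl, f, hf, rfl⟩
  set Yn : ℕ → Subgroup (G → A) := fun n => suppIn Y (X n) with hYn
  have Ymono : ∀ {m n}, m ≤ n → Yn m ≤ Yn n := by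
    rintro m n hmn y ⟨hy, hy'⟩
    exact ⟨hy, fun g hg => hy' g fun h => hg (Xmono hmn h)⟩
  have Yinv : ∀ n, InvUnder K (Yn n) := by
    rintro n k hk y ⟨hy, hy'⟩
    refine ⟨hinv k (hle hk) y hy, fun g hg => hy' _ fun h => hg ?_⟩
    exact Xk n k⁻¹ (K.inv_mem hk) g h
  have Yt : ∀ m n y, y ∈ Yn n → shHom (t ^ m) y ∈ Yn (m + n) := by
    rintro m n y ⟨hy, hy'⟩
    refine ⟨hinv _ (K'.pow_mem ht m) y hy, fun g hg => hy' _ fun h => hg ?_⟩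
    simpa using Xt m n _ h
  set φ : ℕ → (G → A) →* (G → A) := fun n => (resHom (X 0)).comp (shHom (t ^ n)⁻¹) with hφ
  set L : ℕ → Subgroup (G → A) := fun n => (Yn n).map (φ n) with hL
  have φt : ∀ m n y, φ (m + n) (shHom (t ^ m) y) = φ n y := by
    intro m n y
    simp only [hφ, MonoidHom.comp_apply, shHom_shHom]
    congr 2
    rw [pow_add]; group
  have Lmono : Monotone L := by
    intro n m hnm
    rintro _ ⟨y, hy, rfl⟩
    obtain ⟨d, rfl⟩ := Nat.exists_eq_add_of_le' hnm
    exact ⟨_, Yt d n y hy, φt d n y⟩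
  have Linv : ∀ n, InvUnder K (L n) := by
    rintro n k hk _ ⟨y, hy, rfl⟩
    refine ⟨_, Yinv n _ (c1 n k hk) y hy, ?_⟩
    funext g
    have hiff : k⁻¹ * g ∈ X 0 ↔ g ∈ X 0 :=
      ⟨Xk 0 _ (K.inv_mem hk) g, Xk' 0 _ (K.inv_mem hk) g⟩
    simp only [hφ, MonoidHom.comp_apply, shHom_shHom, resHom_apply, shHom_apply, hiff]
    have e : ((t ^ n)⁻¹ * (t ^ n * k * (t ^ n)⁻¹))⁻¹ * g = (t ^ n)⁻¹⁻¹ * (k⁻¹ * g) := by group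
    rw [e]
    by_cases hg : g ∈ X 0
    · rw [if_pos hg, if_pos (hiff.2 hg)]
    · rw [if_neg hg, if_neg (fun h => hg (hiff.1 h))]
  have mem_L : ∀ {y}, y ∈ iSup L ↔ ∃ n, y ∈ L n := by
    intro y
    exact Subgroup.mem_iSup_of_directed Lmono.directed_le
  -- the union is finitely generated
  obtain ⟨E, hEf, hEL, hE⟩ := hK F hF (iSup L) (by
      intro k hk y hy
      obtain ⟨n, hn⟩ := mem_L.1 hy
      exact mem_L.2 ⟨n, Linv n k hk y hn⟩) (by
      intro y hy
      obtain ⟨n, z, hz, rfl⟩ := mem_L.1 hy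
      refine ((hfin _ (hinv ((t ^ n)⁻¹) (K'.inv_mem (K'.pow_mem ht n)) z hz.1))).subset ?_
      intro g hg hg'
      apply hg
      simp only [hφ, MonoidHom.comp_apply, resHom_apply, hg', ite_self]) (by
      intro y hy g hg
      obtain ⟨n, z, hz, rfl⟩ := mem_L.1 hy
      by_cases h : g ∈ X 0
      · obtain ⟨i, hi, l, hl, f, hf, rfl⟩ := h
        obtain rfl : i = 0 := by omega
        exact ⟨l, hl, f, hf, by simp⟩
      · exact absurd (by simp [hφ, resHom_apply, h]) hg)
  obtain ⟨N, hN⟩ : ∃ N, E ⊆ L N := by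
    have : ∀ e : G → A, ∃ n, e ∈ E → e ∈ L n := by
      intro e
      by_cases he : e ∈ E
      · obtain ⟨n, hn⟩ := mem_L.1 (hEL he)
        exact ⟨n, fun _ => hn⟩
      · exact ⟨0, fun h => absurd h he⟩
    choose ν hν using this
    obtain ⟨N, hN⟩ := (hEf.image ν).bddAbove
    exact ⟨N, fun e he => Lmono (hN ⟨e, he, rfl⟩) (hν e he)⟩
  have hLN : ∀ n, L n ≤ L N := fun n =>
    (le_iSup L n).trans (hE.trans (genBy_le (Linv N) hN))
  -- Y_N is finitely generated
  obtain ⟨E', hE'f, hE'Y, hE'⟩ := hK (⋃ i ∈ Set.Iic N, (fun f => t ^ i * f) '' F)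
    ((Set.finite_Iic N).biUnion fun i _ => hF.image _) (Yn N) (Yinv N)
    (fun y hy => hfin y hy.1) (by
      intro y hy g hg
      have : g ∈ X N := by
        by_contra h
        exact hg (hy.2 g h)
      obtain ⟨i, hi, l, hl, f, hf, rfl⟩ := this
      refine ⟨_, c1 i l hl, t ^ i * f, ?_, by group⟩
      exact Set.mem_biUnion (Set.mem_Iic.2 hi) ⟨f, hf, rfl⟩)
  refine ⟨E', hE'f, fun e he => (hE'Y he).1, ?_⟩
  set Z := GenBy K' E' with hZ
  have Zinv : InvUnder K' Z := genBy_inv K' E'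
  have hYN : Yn N ≤ Z := hE'.trans
    (genBy_le (fun k hk => Zinv k (hle hk)) (subset_genBy _ _))
  have hYZ : ∀ n, Yn n ≤ Z := by
    intro n
    induction n with
    | zero => exact (Ymono (Nat.zero_le N)).trans hYN
    | succ n ih =>
      rcases Nat.lt_or_ge n N with h | h
      · exact (Ymono h).trans hYN
      · intro y hy
        obtain ⟨z, hz, hzy⟩ := hLN (n + 1) ⟨y, hy, rfl⟩
        obtain ⟨d, hd⟩ := Nat.exists_eq_add_of_le' (show N ≤ n + 1 by omega)
        have hwY := Yt d N z hz
        have hwφ := φt d N z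
        have hwZ : shHom (t ^ d) z ∈ Z := Zinv _ (K'.pow_mem ht d) z (hYN hz)
        rw [← hd] at hwY hwφ
        rw [hzy] at hwφ
        have hq := (Yn (n+1)).mul_mem hy ((Yn (n+1)).inv_mem hwY)
        have : y * (shHom (t ^ d) z)⁻¹ ∈ Yn n := by
          refine ⟨hq.1, fun g hg => ?_⟩
          by_cases hg1 : g ∈ X (n + 1)
          · have h0 := (Xs n g hg1).resolve_left hg
            have := congrFun hwφ ((t ^ (n + 1))⁻¹ * g)
            simp only [hφ, MonoidHom.comp_apply, resHom_apply, h0, if_true, shHom_apply] at this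
            simp only [inv_inv, mul_inv_cancel_left] at this
            simp only [Pi.mul_apply, Pi.inv_apply, shHom_apply]
            rw [this]
            exact mul_inv_cancel _
          · exact hq.2 g hg1
        have := Z.mul_mem (ih this) hwZ
        simpa using this
  intro y hy
  have hb : ∀ g : G, ∃ m : ℕ, y g ≠ 1 → ∀ m' ≥ m, ∃ n, t ^ m' * g ∈ X n := by
    intro g
    by_cases hg : y g = 1
    · exact ⟨0, fun h => absurd hg h⟩
    · obtain ⟨k', hk', f, hf, rfl⟩ := hsupp y hy g hg
      obtain ⟨j, k, hk, rfl⟩ := hgen k' hk'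
      refine ⟨j.natAbs, fun _ m' hm' => ⟨(m' + j).toNat, (m' + j).toNat, le_rfl, k, hk, f, hf, ?_⟩⟩
      rw [← zpow_natCast, ← zpow_natCast, Int.toNat_of_nonneg (by omega), zpow_add]
      group
  choose μ hμ using hb
  obtain ⟨M, hM⟩ := ((hfin y hy).image μ).bddAbove
  have hb2 : ∀ g : G, ∃ n : ℕ, y g ≠ 1 → t ^ M * g ∈ X n := by
    intro g
    by_cases hg : y g = 1
    · exact ⟨0, fun h => absurd hg h⟩
    · obtain ⟨n, hn⟩ := hμ g hg M (hM ⟨g, hg, rfl⟩)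
      exact ⟨n, fun _ => hn⟩
  choose ν hν using hb2
  obtain ⟨n, hn⟩ := ((hfin y hy).image ν).bddAbove
  have hmem : shHom (t ^ M) y ∈ Yn n := by
    refine ⟨hinv _ (K'.pow_mem ht M) y hy, fun g hg => ?_⟩
    by_contra hne
    rw [shHom_apply] at hne
    have := Xmono (hn ⟨_, hne, rfl⟩) (hν _ hne)
    exact hg (by simpa using this)
  have := Zinv _ (K'.inv_mem (K'.pow_mem ht M)) _ (hYZ n hmem)
  rwa [shHom_shHom, inv_mul_cancel, shHom_one] at this

theorem noethP_comm {K M : Subgroup G} (hK : NoethP A K) (hKM : K ≤ M) (hc : ⁅M, M⁆ ≤ K)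
    (hfg : M.FG) : NoethP A M := by
  obtain ⟨S, hS⟩ := hfg
  have key : ∀ T : Finset G, (T : Set G) ⊆ M → NoethP A (K ⊔ Subgroup.closure (T : Set G)) := by
    classical
    intro T
    induction T using Finset.induction_on with
    | empty => intro _; simpa using hK
    | insert s T _ ih =>
      intro hT
      have hsM : s ∈ M := hT (by simp)
      have hTM : (T : Set G) ⊆ M := fun x hx => hT (by simp [Finset.mem_coe.1 hx])
      set K1 := K ⊔ Subgroup.closure (T : Set G) with hK1
      have hK1M : K1 ≤ M := sup_le hKM ((Subgroup.closure_le _).2 hTM)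
      have hconj : ∀ m ∈ M, ∀ k ∈ K1, m * k * m⁻¹ ∈ K1 := by
        intro m hm k hk
        have h : ⁅m, k⁆ ∈ K1 :=
          (hc.trans le_sup_left) (Subgroup.commutator_mem_commutator hm (hK1M hk))
        have := K1.mul_mem h hk
        simpa [commutatorElement_def] using this
      have heq : K ⊔ Subgroup.closure ((insert s T : Finset G) : Set G)
          = Subgroup.zpowers s ⊔ K1 := by
        rw [Finset.coe_insert, Set.insert_eq, Subgroup.closure_union, hK1,
          Subgroup.zpowers_eq_closure, sup_left_comm]
      rw [heq]
      refine noethP_step (t := s) (ih hTM) le_sup_right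
        (le_sup_left (a := Subgroup.zpowers s) (Subgroup.mem_zpowers s)) (hconj s hsM) ?_ ?_
      · intro k hk
        simpa using hconj s⁻¹ (M.inv_mem hsM) k hk
      · have hnorm : Subgroup.zpowers s ≤ Subgroup.normalizer (K1 : Set G) := by
          rw [Subgroup.zpowers_le, Subgroup.mem_normalizer_iff]
          intro k
          refine ⟨hconj s hsM k, fun h => ?_⟩
          have := hconj s⁻¹ (M.inv_mem hsM) _ h
          simpa [mul_assoc] using this
        intro g hg
        rw [← SetLike.mem_coe, Subgroup.coe_mul_of_left_le_normalizer_right _ _ hnorm] at hg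
        obtain ⟨_, ⟨n, rfl⟩, k, hk, rfl⟩ := hg
        exact ⟨n, k, hk, rfl⟩
  have := key S (by rw [← hS]; exact Subgroup.subset_closure)
  rwa [hS, sup_eq_right.2 hKM] at this

theorem noethP_of_solvable [Finite A] (H : Subgroup G) (hs : IsSolvable H)
    (hfg : ∀ H' : Subgroup H, Group.FG H') : NoethP A H := by
  obtain ⟨n, hn⟩ := hs.solvable
  have key : ∀ m ≤ n, NoethP A ((derivedSeries H (n - m)).map H.subtype) := by
    intro m
    induction m with
    | zero =>
      intro _
      rw [Nat.sub_zero, hn, Subgroup.map_bot]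
      exact noethP_bot
    | succ m ih =>
      intro hm
      have h := ih (by omega)
      have e : n - m = (n - (m + 1)) + 1 := by omega
      rw [e, derivedSeries_succ] at h
      refine noethP_comm h (Subgroup.map_mono (Subgroup.commutator_le_left _ _)) ?_ ?_
      · rw [Subgroup.map_commutator]
      · classical
        obtain ⟨S, hS⟩ := (Group.fg_iff_subgroup_fg _).1 (hfg (derivedSeries H (n - (m + 1))))
        refine ⟨S.image H.subtype, ?_⟩
        rw [← hS, MonoidHom.map_closure, Finset.coe_image]
  have := key n le_rfl
  rw [Nat.sub_self, derivedSeries_zero, ← MonoidHom.range_eq_map, Subgroup.range_subtype] at this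
  exact this

end Aux

/-- Let `G` be virtually polycyclic, `A` a finite group, and `Y` a
`G`-shift-invariant subgroup of the direct product `A^G` (pointwise multiplication)
all of whose elements have finite support.  Then `Y` is finitely orbit-generated:
there is a finite `F ⊆ Y` such that `Y` is generated as a group by the set of
`G`-translates of elements of `F`. -/
theorem homoclinic_subgroup_finitely_orbit_generated
    (G : Type) [Group G] (hvp : VirtuallyPolycyclic G)
    (A : Type) [Group A] [Fintype A]
    (Y : Subgroup (G → A))
    (hinv : ∀ (g : G), ∀ y ∈ Y, shiftMap g y ∈ Y)
    (hsupp : ∀ y ∈ Y, {g : G | y g ≠ 1}.Finite) :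
    ∃ F : Set (G → A), F.Finite ∧ F ⊆ (Y : Set (G → A)) ∧
      Y = Subgroup.closure {z : G → A | ∃ (g : G) (y : G → A), y ∈ F ∧ z = shiftMap g y} := by
  obtain ⟨H, hfi, hs, hfg⟩ := hvp
  have hP : NoethP A H := noethP_of_solvable H hs hfg
  have hfinq : Finite (G ⧸ H) := inferInstance
  obtain ⟨E, hEf, hEY, hE⟩ := hP (Set.range fun q : G ⧸ H => (q.out)⁻¹) (Set.finite_range _) Y
    (fun g _ y hy => hinv g y hy) hsupp (by
      intro y _ g _
      have h : ((g⁻¹ : G) : G ⧸ H).out⁻¹ * g⁻¹ ∈ H :=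
        QuotientGroup.eq.1 (QuotientGroup.out_eq' ((g⁻¹ : G) : G ⧸ H))
      refine ⟨_, H.inv_mem h, _, ⟨((g⁻¹ : G) : G ⧸ H), rfl⟩, ?_⟩
      simp)
  refine ⟨E, hEf, hEY, le_antisymm (hE.trans ?_) ?_⟩
  · apply Subgroup.closure_mono
    rintro z ⟨g, _, y, hy, rfl⟩
    exact ⟨g, y, hy, rfl⟩
  · refine (Subgroup.closure_le _).2 ?_
    rintro z ⟨g, y, hy, rfl⟩
    exact hinv g y (hEY hy)
end

section
/- Let K be a finite field, d ≥ 1, and G a group such that the full vector shift (K^d)^G admits a linear cellular automaton of infinite order, i.e., a continuous G-equivariant K-linear map f : (K^d)^G → (K^d)^G whose iterates f^n (n ∈ ℕ) are pairwise distinct. Then there exists a Lie algebraic G-subshift over K that is not cellwiseable. -/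
/-- A Lie algebraic `G`-subshift over `K` together with its (finite, discrete)
alphabet. -/
structure BundledLieAlgSubshift (K : Type) [Field K] (G : Type) [Group G] where
  A : Type
  [fintypeA : Fintype A]
  [topA : TopologicalSpace A]
  discreteA : DiscreteTopology A
  S : LieAlgSubshift K G A

attribute [instance] BundledLieAlgSubshift.fintypeA BundledLieAlgSubshift.topA

/-- `f` is a linear cellular automaton of infinite order on the full vector shift
`V^G`: a continuous `G`-equivariant `K`-linear self-map whose iterates are pairwise
distinct. -/
def IsInfiniteOrderLinearCA (K : Type) [Field K] (G : Type) [Group G]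
    (V : Type) [AddCommGroup V] [Module K V] [TopologicalSpace V]
    (f : (G → V) → (G → V)) : Prop :=
  Continuous f ∧
  (∀ (g : G) (x : G → V), f (shiftMap g x) = shiftMap g (f x)) ∧
  (∀ x y : G → V, f (x + y) = f x + f y) ∧
  (∀ (c : K) (x : G → V), f (c • x) = c • f x) ∧
  (∀ m n : ℕ, f^[m] = f^[n] → m = n)

/-- The bracket `[(a, x), (b, y)] = (0, a f(y) - b f(x))`. -/
def brk {K G V : Type} [Field K] [Group G] [AddCommGroup V] [Module K V]
    (F : (G → V) →ₗ[K] (G → V)) (x y : G → K × V) : G → K × V :=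
  fun g => (0, (x 1).1 • F (fun h => (y h).2) g - (y 1).1 • F (fun h => (x h).2) g)

lemma snd_brk {K G V : Type} [Field K] [Group G] [AddCommGroup V] [Module K V]
    (F : (G → V) →ₗ[K] (G → V)) (x y : G → K × V) :
    (fun h => (brk F x y h).2) =
      (x 1).1 • F (fun h => (y h).2) - (y 1).1 • F (fun h => (x h).2) := rfl

lemma snd_add' {K G V : Type} [Field K] [AddCommGroup V] (x y : G → K × V) :
    (fun h => ((x + y) h).2) = (fun h => (x h).2) + (fun h => (y h).2) := rfl

lemma snd_smul' {K G V : Type} [Field K] [AddCommGroup V] [Module K V] (a : K) (x : G → K × V) :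
    (fun h => ((a • x) h).2) = a • (fun h => (x h).2) := rfl

/-- The semidirect product of `K` (constant configurations) with `V^G`. -/
def semi {K G V : Type} [Field K] [Group G] [AddCommGroup V] [Module K V]
    [TopologicalSpace K] [DiscreteTopology K] [TopologicalSpace V] [DiscreteTopology V]
    (F : (G → V) →ₗ[K] (G → V)) (hc : Continuous F)
    (hs : ∀ (g : G) (x : G → V), F (shiftMap g x) = shiftMap g (F x)) :
    LieAlgSubshift K G (K × V) where
  X := {x | ∀ g h, (x g).1 = (x h).1}
  closed := by
    simp only [Set.ofPred_forall]
    refine isClosed_iInter fun g => isClosed_iInter fun h => isClosed_eq ?_ ?_ <;> fun_prop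
  shift_mem := fun g x hx a b => hx _ _
  zero := 0
  zero_mem := fun _ _ => rfl
  zero_shift := fun _ => rfl
  add := fun x y => x + y
  add_mem := fun x hx y hy g h => by simp [hx g h, hy g h]
  add_contOn := by
    apply Continuous.continuousOn; fun_prop
  add_shift := fun _ _ _ _ _ => rfl
  neg := fun x => -x
  neg_mem := fun x hx g h => by simp [hx g h]
  neg_contOn := by
    apply Continuous.continuousOn; fun_prop
  neg_shift := fun _ _ _ => rfl
  smul := fun c x => c • x
  smul_mem := fun c x hx g h => by simp [hx g h]
  smul_contOn := fun c => by
    apply Continuous.continuousOn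
    refine continuous_pi fun g => ?_
    exact (continuous_of_discreteTopology (f := fun v : K × V => c • v)).comp (continuous_apply g)
  smul_shift := fun _ _ _ _ => rfl
  br := brk F
  br_mem := fun _ _ _ _ _ _ => rfl
  br_contOn := by
    apply Continuous.continuousOn
    refine continuous_pi fun g => ?_
    have key : Continuous (fun p : (K × V) × (K × V) => p.1.1 • p.2.2 - p.2.1 • p.1.2) :=
      continuous_of_discreteTopology
    have h1 : Continuous (fun p : (G → K × V) × (G → K × V) =>
        F (fun h => (p.2 h).2) g) :=
      (continuous_apply g).comp (hc.comp (by fun_prop))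
    have h2 : Continuous (fun p : (G → K × V) × (G → K × V) =>
        F (fun h => (p.1 h).2) g) :=
      (continuous_apply g).comp (hc.comp (by fun_prop))
    have h3 : Continuous (fun p : (G → K × V) × (G → K × V) =>
        (((p.1 1).1, F (fun h => (p.1 h).2) g), ((p.2 1).1, F (fun h => (p.2 h).2) g))) := by
      fun_prop
    exact continuous_const.prodMk (key.comp h3)
  br_shift := fun g x hx y hy => by
    have e1 : F (fun h => (shiftMap g x h).2) = shiftMap g (F fun h => (x h).2) := hs g fun h => (x h).2
    have e2 : F (fun h => (shiftMap g y h).2) = shiftMap g (F fun h => (y h).2) := hs g fun h => (y h).2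
    funext k
    rw [brk, e1, e2]
    simp only [shiftMap]
    rw [hx (g⁻¹ * 1) 1, hy (g⁻¹ * 1) 1]
    rfl
  add_assoc' := fun x _ y _ z _ => add_assoc x y z
  add_comm' := fun x _ y _ => add_comm x y
  zero_add' := fun x _ => zero_add x
  neg_add' := fun x _ => neg_add_cancel x
  one_smul' := fun x _ => one_smul K x
  zero_smul' := fun x _ => zero_smul K x
  mul_smul' := fun a b x _ => mul_smul a b x
  smul_add' := fun a x _ y _ => smul_add a x y
  add_smul' := fun a b x _ => add_smul a b x
  br_add_left := fun x _ y _ z _ => by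
    funext k
    ext1
    · simp [brk]
    · simp only [brk]
      rw [snd_add', map_add]
      simp only [brk, Pi.add_apply, Prod.fst_add, Prod.snd_add]
      module
  br_add_right := fun x _ y _ z _ => by
    funext k
    ext1
    · simp [brk]
    · simp only [brk]
      rw [snd_add', map_add]
      simp only [brk, Pi.add_apply, Prod.fst_add, Prod.snd_add]
      module
  br_smul_left := fun a x _ y _ => by
    funext k
    ext1
    · simp [brk]
    · simp only [brk]
      rw [snd_smul', map_smul]
      simp only [brk, Pi.smul_apply, Prod.smul_fst, Prod.smul_snd, smul_eq_mul]
      module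
  br_smul_right := fun a x _ y _ => by
    funext k
    ext1
    · simp [brk]
    · simp only [brk]
      rw [snd_smul', map_smul]
      simp only [brk, Pi.smul_apply, Prod.smul_fst, Prod.smul_snd, smul_eq_mul]
      module
  br_self := fun x _ => by
    funext k
    ext1
    · simp [brk]
    · simp [brk]
  jacobi := fun x _ y _ z _ => by
    funext k
    ext1
    · simp [brk]
    · have e : ∀ u v w : G → K × V, brk F (brk F u v) w k =
          (0, - ((w 1).1 • ((u 1).1 • F (F fun h => (v h).2) k
            - (v 1).1 • F (F fun h => (u h).2) k))) := by
        intro u v w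
        have h1 : (brk F u v 1).1 = 0 := rfl
        rw [brk, snd_brk, h1, map_sub, map_smul, map_smul]
        simp
      simp only [Pi.add_apply, e, Prod.snd_add, Pi.zero_apply, Prod.snd_zero]
      module

/-- If the full vector shift `(K^d)^G` (`d ≥ 1`) admits a linear
cellular automaton of infinite order, then `G` admits a Lie algebraic `G`-subshift
over `K` that is not cellwiseable. -/
theorem exists_noncellwiseable_lie_subshift
    (K : Type) [Field K] [Fintype K] [TopologicalSpace K] [DiscreteTopology K]
    (G : Type) [Group G] (d : ℕ) (hd : 1 ≤ d)
    (f : (G → (Fin d → K)) → (G → (Fin d → K)))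
    (hf : IsInfiniteOrderLinearCA K G (Fin d → K) f) :
    ∃ T : BundledLieAlgSubshift K G, ¬ T.S.Cellwiseable := by
  obtain ⟨hc, hs, ha, hm, hi⟩ := hf
  let F : (G → (Fin d → K)) →ₗ[K] (G → (Fin d → K)) :=
    { toFun := f, map_add' := ha, map_smul' := hm }
  refine ⟨⟨K × (Fin d → K), inferInstance, semi F hc hs⟩, ?_⟩
  rintro ⟨C, φ, ψ, hbij, -, -, -, -, -, -, -, -, hbr⟩
  let t : G → K × (Fin d → K) := fun _ => (1, 0)
  have ht : t ∈ (semi F hc hs).X := fun _ _ => rfl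
  let e : (G → (Fin d → K)) → (G → K × (Fin d → K)) := fun x g => (0, x g)
  have he : ∀ x, e x ∈ (semi F hc hs).X := fun x _ _ => rfl
  have hte : ∀ x, (semi F hc hs).br t (e x) = e (f x) := by
    intro x
    funext g
    change brk F t (e x) g = e (f x) g
    simp [brk, t, e, F]
  have hstep : ∀ x h, φ (e (f x)) h = ⁅φ t h, φ (e x) h⁆ := by
    intro x h
    rw [← hte x]
    exact congrFun (hbr t ht (e x) (he x)) h
  have hiter : ∀ n x h, φ (e (f^[n] x)) h = (fun b => ⁅φ t h, b⁆)^[n] (φ (e x) h) := by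
    intro n
    induction n with
    | zero => intro x h; rfl
    | succ n ih =>
      intro x h
      rw [Function.iterate_succ_apply', hstep, ih, Function.iterate_succ_apply']
  let P : ℕ → (C.B → C.B → C.B) := fun n c => (fun b => ⁅c, b⁆)^[n]
  have : Finite C.B := Finite.of_fintype _
  obtain ⟨m, n, hmn, hP⟩ := Finite.exists_ne_map_eq_of_infinite P
  apply hmn
  apply hi
  funext x
  have h1 : φ (e (f^[m] x)) = φ (e (f^[n] x)) := by
    funext h
    rw [hiter, hiter]
    exact congrFun (congrFun hP (φ t h)) (φ (e x) h)
  have h2 := hbij.injOn (he _) (he _) h1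
  funext g
  exact congrArg Prod.snd (congrFun h2 g)
end

section
/- Let G be a finitely generated group containing an element of infinite order, and let K be a finite field. Then there exists a Lie algebraic G-subshift over K which is not cellwiseable and whose co-homoclinic factor is the additive group of K (the quotient of (X, +) by the closure of the homoclinic group Δ_X is isomorphic to (K, +)). -/
/-- The co-homoclinic factor of `X`, i.e. the quotient of the additive group `(X, +)`
by the topological closure of the homoclinic group `Δ_X`, is isomorphic as a group to
the additive group of `K`: there is a surjective additive map `q : X → K` whose kernel
is exactly `closure Δ_X`. -/
def LieAlgSubshift.CohomoclinicFactorIsoAddK {K : Type} [Field K] {G : Type} [Group G]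
    {A : Type} [TopologicalSpace A] (S : LieAlgSubshift K G A) : Prop :=
  ∃ q : (G → A) → K,
    (∀ a : K, ∃ x ∈ S.X, q x = a) ∧
    (∀ x ∈ S.X, ∀ y ∈ S.X, q (S.add x y) = q x + q y) ∧
    (∀ x ∈ S.X, (q x = 0 ↔ x ∈ closure S.delta))

namespace LieShiftAux

variable {K : Type} [Field K] {G : Type} [Group G]

/-- Bracket on `K^G ⋊ K`, where `K` acts by powers of the right translation by `t`. -/
def brk (t : G) (x y : G → K × K) : G → K × K :=
  fun h => ((x h).2 * (y (h * t)).1 - (y h).2 * (x (h * t)).1, 0)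

/-- Pairs of an arbitrary configuration and a constant. -/
def carrier (K G : Type) [Group G] : Set (G → K × K) := {x | ∀ h, (x h).2 = (x 1).2}

/-- The Lie algebraic subshift. -/
def sub [TopologicalSpace (K × K)] [DiscreteTopology (K × K)] (t : G) :
    LieAlgSubshift K G (K × K) where
  X := carrier K G
  closed := by
    have : carrier K G = ⋂ h, {x : G → K × K | (x h).2 = (x 1).2} := by
      ext x; simp [carrier]
    rw [this]
    refine isClosed_iInter fun h => ?_
    have hc : Continuous (fun x : G → K × K => (x h, x 1)) := by fun_prop
    exact (isClosed_discrete {p : (K × K) × (K × K) | p.1.2 = p.2.2}).preimage hc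
  shift_mem g x hx h := by
    show (x _).2 = (x _).2
    rw [hx, hx (g⁻¹ * 1)]
  zero := fun _ => 0
  zero_mem h := rfl
  zero_shift g := rfl
  add x y := fun h => x h + y h
  add_mem x hx y hy h := by
    show (x h).2 + (y h).2 = (x 1).2 + (y 1).2
    rw [hx, hy]
  add_contOn := by
    refine (continuous_pi fun h => ?_).continuousOn
    have hc : Continuous (fun p : (G → K × K) × (G → K × K) => (p.1 h, p.2 h)) := by fun_prop
    exact (continuous_of_discreteTopology
      (f := fun p : (K × K) × (K × K) => p.1 + p.2)).comp hc
  add_shift g x hx y hy := rfl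
  neg x := fun h => - x h
  neg_mem x hx h := by
    show -(x h).2 = -(x 1).2
    rw [hx]
  neg_contOn := by
    refine (continuous_pi fun h => ?_).continuousOn
    exact (continuous_of_discreteTopology
      (f := fun p : (K × K) => - p)).comp (continuous_apply h)
  neg_shift g x hx := rfl
  smul c x := fun h => c • x h
  smul_mem c x hx h := by
    show c * (x h).2 = c * (x 1).2
    rw [hx]
  smul_contOn c := by
    refine (continuous_pi fun h => ?_).continuousOn
    exact (continuous_of_discreteTopology
      (f := fun p : (K × K) => c • p)).comp (continuous_apply h)
  smul_shift c g x hx := rfl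
  br := brk t
  br_mem x hx y hy h := rfl
  br_contOn := by
    refine (continuous_pi fun h => ?_).continuousOn
    have hc : Continuous (fun p : (G → K × K) × (G → K × K) =>
      ((p.1 h, p.2 h), (p.1 (h * t), p.2 (h * t)))) := by fun_prop
    exact (continuous_of_discreteTopology
      (f := fun p : ((K × K) × (K × K)) × ((K × K) × (K × K)) =>
        ((p.1.1.2 * p.2.2.1 - p.1.2.2 * p.2.1.1, 0) : K × K))).comp hc
  br_shift g x hx y hy := by
    funext h
    simp [shiftMap, brk, mul_assoc]
  add_assoc' x hx y hy z hz := by funext h; exact add_assoc _ _ _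
  add_comm' x hx y hy := by funext h; exact add_comm _ _
  zero_add' x hx := by funext h; exact zero_add _
  neg_add' x hx := by funext h; exact neg_add_cancel _
  one_smul' x hx := by funext h; exact one_smul _ _
  zero_smul' x hx := by funext h; exact zero_smul _ _
  mul_smul' a b x hx := by funext h; exact mul_smul _ _ _
  smul_add' a x hx y hy := by funext h; exact smul_add _ _ _
  add_smul' a b x hx := by funext h; exact add_smul _ _ _
  br_add_left x hx y hy z hz := by
    funext h; ext <;> simp [brk]; ring
  br_add_right x hx y hy z hz := by
    funext h; ext <;> simp [brk]; ring
  br_smul_left a x hx y hy := by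
    funext h; ext <;> simp [brk]; ring
  br_smul_right a x hx y hy := by
    funext h; ext <;> simp [brk]; ring
  br_self x hx := by
    funext h; ext <;> simp [brk]
  jacobi x hx y hy z hz := by
    funext h
    have hx' := hx h
    have hy' := hy h
    have hz' := hz h
    have hx2 := hx (h * t)
    have hy2 := hy (h * t)
    have hz2 := hz (h * t)
    ext
    · simp only [brk, Prod.fst_add, Prod.fst_zero, hx', hy', hz', hx2, hy2, hz2]; ring
    · simp [brk]

/-- The element `(x, 0)`. -/
def emb (x : G → K) : G → K × K := fun h => (x h, 0)

/-- The element `(0, 1)`. -/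
def der : G → K × K := fun _ => (0, 1)

lemma emb_mem (x : G → K) : emb x ∈ carrier K G := fun _ => rfl

lemma der_mem : (der : G → K × K) ∈ carrier K G := fun _ => rfl

lemma brk_der (t : G) (x : G → K) : brk t der (emb x) = emb (fun h => x (h * t)) := by
  funext h; ext <;> simp [brk, der, emb]

lemma not_cellwiseable [TopologicalSpace (K × K)] [DiscreteTopology (K × K)] (t : G)
    (ht : ¬ IsOfFinOrder t) : ¬ (sub (K := K) t).Cellwiseable := by
  rintro ⟨C, φ, ψ, hbij, -, -, -, hsh, -, -, -, -, hbr⟩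
  have hX : (sub (K := K) t).X = carrier K G := rfl
  rw [hX] at *
  set d : C.B := φ der 1 with hd
  have hconst : ∀ h, φ der h = d := by
    intro h
    have := congrFun (hsh h⁻¹ der der_mem) 1
    simp only [shiftMap, inv_inv, mul_one] at this
    exact this.symm
  have key : ∀ (n : ℕ) (x : G → K) (h : G),
      φ (emb (fun h => x (h * t ^ n))) h = (fun b => ⁅d, b⁆)^[n] (φ (emb x) h) := by
    intro n
    induction n with
    | zero => intro x h; simp
    | succ n ih =>
      intro x h
      have h1 := hbr der der_mem (emb (fun h => x (h * t ^ n))) (emb_mem _)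
      have h2 : (sub (K := K) t).br der (emb (fun h => x (h * t ^ n)))
          = emb (fun h => x (h * t ^ (n + 1))) := by
        refine (brk_der t _).trans ?_
        congr 1
        funext h
        rw [mul_assoc, pow_succ']
      rw [h2] at h1
      rw [h1, Function.iterate_succ_apply', ← ih]
      show ⁅φ der h, _⁆ = ⁅d, _⁆
      rw [hconst]
  obtain ⟨m, n, hmn, he⟩ := Finite.exists_ne_map_eq_of_infinite
    (fun n : ℕ => (fun b : C.B => ⁅d, b⁆)^[n])
  apply hmn
  apply injective_pow_iff_not_isOfFinOrder.mpr ht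
  classical
  let x : G → K := fun h => if h = t ^ m then 1 else 0
  have h3 : φ (emb (fun h => x (h * t ^ m))) = φ (emb (fun h => x (h * t ^ n))) := by
    funext h
    rw [key, key]
    exact congrFun he _
  have h4 := hbij.injOn (emb_mem _) (emb_mem _) h3
  have h5 := congrArg Prod.fst (congrFun h4 1)
  by_contra hne
  have hne' : ¬ (t ^ n = t ^ m) := fun h => hne h.symm
  simp [emb, x, hne'] at h5

lemma cohom [TopologicalSpace (K × K)] [DiscreteTopology (K × K)] (t : G)
    [Infinite G] : (sub (K := K) t).CohomoclinicFactorIsoAddK := by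
  refine ⟨fun x => (x 1).2, fun a => ⟨fun _ => (0, a), fun _ => rfl, rfl⟩,
    fun x _ y _ => rfl, fun x hx => ⟨fun h0 => ?_, fun h => ?_⟩⟩
  · classical
    have hx0 : ∀ h, (x h).2 = 0 := fun h => (hx h).trans h0
    refine mem_closure_of_tendsto (b := (Filter.atTop : Filter (Finset G)))
      (f := fun s h => if h ∈ s then x h else 0) ?_ (Filter.Eventually.of_forall fun s => ⟨?_, ?_⟩)
    · refine tendsto_pi_nhds.mpr fun h => ?_
      refine tendsto_const_nhds.congr' ?_
      filter_upwards [Filter.eventually_ge_atTop {h}] with s hs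
      have : h ∈ s := hs (Finset.mem_singleton_self h)
      simp [this]
    · intro h
      have : ∀ h, (if h ∈ s then x h else 0).2 = 0 := by
        intro h; split_ifs
        · exact hx0 h
        · rfl
      exact (this h).trans (this 1).symm
    · refine s.finite_toSet.subset fun h hh => ?_
      by_contra hs
      have hs' : h ∉ s := hs
      exact hh (by simp [hs', sub])
  · have hcl : IsClosed {x : G → K × K | (x 1).2 = 0} := by
      have hc : Continuous (fun x : G → K × K => x 1) := continuous_apply (1 : G)
      exact (isClosed_discrete {p : K × K | p.2 = 0}).preimage hc
    refine closure_minimal (fun y hy => ?_) hcl h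
    obtain ⟨hyX, hyf⟩ := hy
    obtain ⟨g, hg⟩ := hyf.exists_notMem
    have hg' : y g = 0 := by
      by_contra hne
      exact hg hne
    have := hyX g
    rw [hg'] at this
    exact this.symm

end LieShiftAux

/-- If `G` is a finitely generated group containing an element of
infinite order and `K` is a finite field, then `G` admits a Lie algebraic `G`-subshift
over `K` that is not cellwiseable and whose co-homoclinic factor is the additive group
of `K`. -/
theorem exists_noncellwiseable_lie_subshift_of_nontorsion
    (K : Type) [Field K] [Fintype K]
    (G : Type) [Group G] (hFG : Group.FG G)
    (hg : ∃ g : G, ¬ IsOfFinOrder g) :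
    ∃ T : BundledLieAlgSubshift K G,
      ¬ T.S.Cellwiseable ∧ T.S.CohomoclinicFactorIsoAddK := by
  obtain ⟨t, ht⟩ := hg
  let _ : TopologicalSpace (K × K) := ⊥
  have hdisc : DiscreteTopology (K × K) := ⟨rfl⟩
  have : Infinite G :=
    Infinite.of_injective (fun n : ℕ => t ^ n) (injective_pow_iff_not_isOfFinOrder.mpr ht)
  exact ⟨{ A := K × K, discreteA := hdisc, S := LieShiftAux.sub t },
    LieShiftAux.not_cellwiseable t ht, LieShiftAux.cohom t⟩
end

section
/- Let G be the additive group ⊕_{n ∈ ℕ} ℤ/2ℤ (the direct sum of countably many copies of ℤ/2ℤ). There exists a closed G-shift-invariant 𝔽₂-linear subspace X of (ℤ/2ℤ)^G (with pointwise vector space operations) such that the set Δ_X of finitely supported elements of X is not finitely orbit-generated: there is no finite set F ⊆ Δ_X such that Δ_X equals the subgroup of (X, +) generated by {g·y : g ∈ G, y ∈ F}. -/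
/-- The left shift action of an additive group `G` on `M^G`: `(g • x) h = x (-g + h)`. -/
def shiftAdd {G M : Type} [AddGroup G] (g : G) (x : G → M) : G → M :=
  fun h => x (-g + h)

/-- The set of finitely supported elements of `X ⊆ (ℤ/2ℤ)^G`. -/
def deltaOf {G : Type} (X : Set (G → ZMod 2)) : Set (G → ZMod 2) :=
  {x | x ∈ X ∧ {g : G | x g ≠ 0}.Finite}

/-- The group `⊕ ℤ/2ℤ`. -/
abbrev GG := ℕ →₀ ZMod 2

/-- Multiplication by `1 + e_i`. -/
noncomputable def opD (i : ℕ) : Module.End (ZMod 2) (GG → ZMod 2) where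
  toFun x := fun g => x g + x (g + Finsupp.single i 1)
  map_add' x y := by
    funext g
    simp only [Pi.add_apply]
    ring
  map_smul' c x := by
    funext g
    simp [mul_add]

theorem opD_apply (i : ℕ) (x : GG → ZMod 2) (g : GG) :
    opD i x g = x g + x (g + Finsupp.single i 1) := rfl

theorem gg_add_self (g : GG) : g + g = 0 := by
  ext i
  exact CharTwo.add_self_eq_zero _

theorem opD_comm (i j : ℕ) : Commute (opD i) (opD j) := by
  apply LinearMap.ext
  intro x
  funext g
  simp only [Module.End.mul_apply, opD_apply]
  rw [add_right_comm g]
  ring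

theorem opD_sq (i : ℕ) : opD i * opD i = 0 := by
  apply LinearMap.ext
  intro x
  funext g
  simp only [Module.End.mul_apply, opD_apply, add_assoc g, gg_add_self]
  rw [add_zero, add_comm (x (g + _)) (x g)]
  exact CharTwo.add_self_eq_zero _

/-- Product of the `opD i` over a list. -/
noncomputable def opL (l : List ℕ) : Module.End (ZMod 2) (GG → ZMod 2) := (l.map opD).prod

theorem opL_cons (i : ℕ) (l : List ℕ) : opL (i :: l) = opD i * opL l := by
  simp [opL]

theorem opL_nil : opL [] = 1 := by
  simp [opL]

theorem opL_append (l m : List ℕ) : opL (l ++ m) = opL l * opL m := by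
  simp [opL]

theorem opD_comm_opL (i : ℕ) (l : List ℕ) : Commute (opD i) (opL l) := by
  induction l with
  | nil => rw [opL_nil]; exact Commute.one_right _
  | cons j l ih => rw [opL_cons]; exact (opD_comm i j).mul_right ih

theorem opD_mul_opL (i : ℕ) (l : List ℕ) (h : i ∈ l) : opD i * opL l = 0 := by
  induction l with
  | nil => simp at h
  | cons j l ih =>
    rw [opL_cons, ← mul_assoc]
    rcases List.mem_cons.1 h with rfl | h
    · rw [opD_sq, zero_mul]
    · rw [(opD_comm i j).eq, mul_assoc, ih h, mul_zero]

theorem opL_mul_opL (i : ℕ) (l m : List ℕ) (h : i ∈ l) (h' : i ∈ m) : opL l * opL m = 0 := by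
  induction l with
  | nil => simp at h
  | cons j l ih =>
    rw [opL_cons]
    rcases List.mem_cons.1 h with rfl | h
    · rw [(opD_comm_opL i l).eq, mul_assoc, opD_mul_opL i m h', mul_zero]
    · rw [mul_assoc, ih h, mul_zero]

/-- `y` vanishes where the `i`-th coordinate is nonzero. -/
def Avoid (i : ℕ) (y : GG → ZMod 2) : Prop := ∀ g : GG, g i ≠ 0 → y g = 0

theorem Avoid.opD {i j : ℕ} (hij : i ≠ j) {y : GG → ZMod 2} (h : Avoid i y) :
    Avoid i (opD j y) := by
  intro g hg
  rw [opD_apply, h g hg, h, add_zero]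
  rw [Finsupp.add_apply, Finsupp.single_eq_of_ne hij, add_zero]
  exact hg

theorem Avoid.opL {i : ℕ} {l : List ℕ} (hi : i ∉ l) {y : GG → ZMod 2} (h : Avoid i y) :
    Avoid i (opL l y) := by
  induction l with
  | nil => simpa [opL_nil] using h
  | cons j l ih =>
    rw [opL_cons]
    simp only [List.mem_cons, not_or] at hi
    exact (ih hi.2).opD hi.1

theorem Avoid.eq_zero {i : ℕ} {y : GG → ZMod 2} (h : Avoid i y) (hD : _root_.opD i y = 0) :
    y = 0 := by
  funext g
  by_cases hg : g i = 0
  · have h1 := congrFun hD g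
    rw [opD_apply, h (g + Finsupp.single i 1) (by simp [hg]), add_zero] at h1
    exact h1
  · exact h g hg

theorem Avoid.opL_eq_zero {l : List ℕ} (hl : l.Nodup) {y : GG → ZMod 2}
    (h : ∀ i ∈ l, Avoid i y) (hD : _root_.opL l y = 0) : y = 0 := by
  induction l with
  | nil => simpa [opL_nil] using hD
  | cons j l ih =>
    rw [opL_cons] at hD
    have hn := List.nodup_cons.1 hl
    refine ih hn.2 (fun i hi => h i (List.mem_cons_of_mem _ hi)) ?_
    exact ((h j List.mem_cons_self).opL hn.1).eq_zero hD

theorem opD_shift (i : ℕ) (g : GG) (x : GG → ZMod 2) :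
    opD i (shiftAdd g x) = shiftAdd g (opD i x) := by
  funext h
  simp only [opD_apply, shiftAdd, add_assoc]

theorem opL_shift (l : List ℕ) (g : GG) (x : GG → ZMod 2) :
    opL l (shiftAdd g x) = shiftAdd g (opL l x) := by
  induction l with
  | nil => simp [opL_nil]
  | cons j l ih => rw [opL_cons, Module.End.mul_apply, Module.End.mul_apply, ih, opD_shift]

theorem opD_continuous (i : ℕ) : Continuous (opD i) := by
  apply continuous_pi
  intro g
  have hc : Continuous (fun p : ZMod 2 × ZMod 2 => p.1 + p.2) := continuous_of_discreteTopology
  have h1 : Continuous (fun x : GG → ZMod 2 => x g) := continuous_apply g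
  have h2 : Continuous (fun x : GG → ZMod 2 => x (g + Finsupp.single i 1)) :=
    continuous_apply (g + Finsupp.single i 1)
  exact hc.comp (h1.prodMk h2)

theorem opL_continuous (l : List ℕ) : Continuous (opL l) := by
  induction l with
  | nil => rw [opL_nil]; exact continuous_id
  | cons j l ih => rw [opL_cons]; exact (opD_continuous j).comp ih

theorem opD_finite (i : ℕ) (x : GG → ZMod 2) (h : {g | x g ≠ 0}.Finite) :
    {g | opD i x g ≠ 0}.Finite := by
  have h2 : ((fun g : GG => g + Finsupp.single i 1) ⁻¹' {g | x g ≠ 0}).Finite :=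
    h.preimage (add_left_injective _).injOn
  refine (h.union h2).subset ?_
  intro g hg
  by_contra hc
  simp only [Set.mem_union, Set.mem_ofPred_eq, Set.mem_preimage, not_or, not_not] at hc
  exact hg (by rw [opD_apply, hc.1, hc.2, add_zero])

theorem opL_finite (l : List ℕ) (x : GG → ZMod 2) (h : {g | x g ≠ 0}.Finite) :
    {g | opL l x g ≠ 0}.Finite := by
  induction l with
  | nil => simpa [opL_nil] using h
  | cons j l ih => rw [opL_cons]; exact opD_finite j _ ih

/-- `a_0, …, a_{n-1}` -/
def lA (n : ℕ) : List ℕ := (List.range n).map (fun i => 2 * i)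
/-- `b_0, …, b_{n-1}` -/
def lB (n : ℕ) : List ℕ := (List.range n).map (fun i => 2 * i + 1)

/-- The subshift. -/
noncomputable def theX : Submodule (ZMod 2) (GG → ZMod 2) :=
  ⨅ n : ℕ, LinearMap.ker (opL ((2 * n + 1) :: (2 * n) :: lA n))

theorem mem_theX (x : GG → ZMod 2) :
    x ∈ theX ↔ ∀ n : ℕ, opL ((2 * n + 1) :: (2 * n) :: lA n) x = 0 := by
  simp [theX, Submodule.mem_iInf]

/-- Delta at zero. -/
noncomputable def del : GG → ZMod 2 := Pi.single 0 1

theorem del_avoid (i : ℕ) : Avoid i del := by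
  intro g hg
  have : g ≠ 0 := by
    rintro rfl
    exact hg rfl
  simp [del, this]

theorem del_ne : del ≠ 0 := by
  intro h
  have := congrFun h 0
  simp [del] at this

theorem del_finite : {g | del g ≠ 0}.Finite := by
  refine (Set.finite_singleton (0 : GG)).subset ?_
  intro g hg
  by_contra hc
  exact hg (by simp only [Set.mem_singleton_iff] at hc; simp [del, hc])

/-- The witness. -/
noncomputable def wit (n : ℕ) : GG → ZMod 2 := opL ((2 * n) :: lB n) del

theorem wit_mem (n : ℕ) : wit n ∈ theX := by
  rw [mem_theX]
  intro m
  have key : ∃ i, i ∈ ((2 * m + 1) :: (2 * m) :: lA m) ∧ i ∈ ((2 * n) :: lB n) := by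
    rcases lt_trichotomy m n with h | h | h
    · exact ⟨2 * m + 1, by simp, by simp [lB, h]⟩
    · exact ⟨2 * n, by simp [h], by simp⟩
    · exact ⟨2 * n, by simp [lA, h], by simp⟩
  obtain ⟨i, h1, h2⟩ := key
  rw [wit, ← Module.End.mul_apply, opL_mul_opL i _ _ h1 h2, LinearMap.zero_apply]

theorem wit_ne (n : ℕ) : opL (lA n) (wit n) ≠ 0 := by
  intro h
  rw [wit, ← Module.End.mul_apply, ← opL_append] at h
  refine del_ne (Avoid.opL_eq_zero ?_ (fun i _ => del_avoid i) h)
  rw [List.nodup_append']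
  refine ⟨?_, ?_, ?_⟩
  · exact List.nodup_range.map (fun a b hab => by simpa using hab)
  · rw [List.nodup_cons]
    refine ⟨?_, List.nodup_range.map (fun a b hab => by simpa using hab)⟩
    simp only [lB, List.mem_map, List.mem_range]
    omega
  · intro i h1 h2
    simp only [lA, lB, List.mem_cons, List.mem_map, List.mem_range] at h1 h2
    omega

theorem kill {n : ℕ} {y : GG → ZMod 2} (hy : y ∈ theX) (h : ∀ i, n ≤ i → Avoid i y) :
    opL (lA n) y = 0 := by
  have h1 := (mem_theX y).1 hy n
  have e : ∀ i, 2 * n ≤ i → i ∉ lA n := by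
    intro i hi
    simp only [lA, List.mem_map, List.mem_range]
    omega
  rw [opL_cons, opL_cons, Module.End.mul_apply, Module.End.mul_apply] at h1
  have a1 : Avoid (2 * n + 1) (opL (lA n) y) :=
    (h _ (by omega)).opL (e _ (by omega))
  have a2 : Avoid (2 * n) (opL (lA n) y) :=
    (h _ (by omega)).opL (e _ (by omega))
  exact a2.eq_zero ((a1.opD (by omega)).eq_zero h1)

theorem exists_bound (F : Set (GG → ZMod 2)) (hF : F.Finite)
    (h : ∀ y ∈ F, {g | y g ≠ 0}.Finite) :
    ∃ n : ℕ, ∀ y ∈ F, ∀ i, n ≤ i → Avoid i y := by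
  have hfin : (⋃ y ∈ F, ⋃ g ∈ {g | y g ≠ 0}, (g.support : Set ℕ)).Finite :=
    hF.biUnion fun y hy => (h y hy).biUnion fun g _ => g.support.finite_toSet
  obtain ⟨n, hn⟩ := hfin.bddAbove
  refine ⟨n + 1, fun y hy i hi g hg => ?_⟩
  by_contra hc
  have : i ≤ n := hn (by
    simp only [Set.mem_iUnion]
    exact ⟨y, hy, g, hc, by simpa using hg⟩)
  omega

/-- Let `G = ⊕_{n ∈ ℕ} ℤ/2ℤ`.  There is a closed `G`-shift-invariant
`𝔽₂`-linear subspace `X` of `(ℤ/2ℤ)^G` whose set `Δ_X` of finitely supported elements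
is not finitely orbit-generated: no finite `F ⊆ Δ_X` is such that `Δ_X` equals the
subgroup of `(X, +)` generated by the `G`-translates of elements of `F`. -/
theorem exists_nonFOG_vector_shift_on_directSum :
    ∃ X : Submodule (ZMod 2) ((ℕ →₀ ZMod 2) → ZMod 2),
      IsClosed (X : Set ((ℕ →₀ ZMod 2) → ZMod 2)) ∧
      (∀ (g : ℕ →₀ ZMod 2), ∀ x ∈ X, shiftAdd g x ∈ X) ∧
      ¬ ∃ F : Set ((ℕ →₀ ZMod 2) → ZMod 2), F.Finite ∧
          F ⊆ deltaOf (X : Set ((ℕ →₀ ZMod 2) → ZMod 2)) ∧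
          deltaOf (X : Set ((ℕ →₀ ZMod 2) → ZMod 2)) =
            (AddSubgroup.closure
              {z | ∃ (g : ℕ →₀ ZMod 2) (y : (ℕ →₀ ZMod 2) → ZMod 2),
                y ∈ F ∧ z = shiftAdd g y} : Set ((ℕ →₀ ZMod 2) → ZMod 2)) := by
  refine ⟨theX, ?_, ?_, ?_⟩
  · have : (theX : Set (GG → ZMod 2)) =
        ⋂ n : ℕ, (opL ((2 * n + 1) :: (2 * n) :: lA n)) ⁻¹' {0} := by
      ext x
      simp [mem_theX]
    rw [this]
    exact isClosed_iInter fun n => isClosed_singleton.preimage (opL_continuous _)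
  · intro g x hx
    rw [mem_theX] at hx ⊢
    intro n
    rw [opL_shift, hx n]
    rfl
  · rintro ⟨F, hF, hsub, heq⟩
    obtain ⟨n, hn⟩ := exists_bound F hF (fun y hy => (hsub hy).2)
    have hw : wit n ∈ deltaOf (theX : Set (GG → ZMod 2)) :=
      ⟨wit_mem n, opL_finite _ _ del_finite⟩
    rw [heq] at hw
    have hle : AddSubgroup.closure
        {z | ∃ (g : ℕ →₀ ZMod 2) (y : (ℕ →₀ ZMod 2) → ZMod 2), y ∈ F ∧ z = shiftAdd g y} ≤
        (LinearMap.ker (opL (lA n))).toAddSubgroup := by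
      rw [AddSubgroup.closure_le]
      rintro z ⟨g, y, hy, rfl⟩
      change opL (lA n) (shiftAdd g y) = 0
      rw [opL_shift, kill (hsub hy).1 (hn y hy)]
      rfl
    exact wit_ne n (hle hw)
end

section
/- Let G be the lamplighter group ℤ₂ ≀ ℤ, realized as the semidirect product (⊕_{n ∈ ℤ} ℤ/2ℤ) ⋊ ℤ where ℤ acts by shifting the index. There exists a closed G-shift-invariant 𝔽₂-linear subspace X of (ℤ/2ℤ)^G (with pointwise vector space operations) such that the set Δ_X of finitely supported elements of X is not finitely orbit-generated: there is no finite set F ⊆ Δ_X such that Δ_X equals the subgroup of (X, +) generated by {g·y : g ∈ G, y ∈ F}. -/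
/-- The shift automorphism of `⊕_{n ∈ ℤ} ℤ/2ℤ` moving every coordinate one step. -/
noncomputable def lampShiftAut : MulAut (Multiplicative (ℤ →₀ ZMod 2)) :=
  AddEquiv.toMultiplicative (Finsupp.domCongr (M := ZMod 2) (Equiv.addRight (1 : ℤ)))

/-- The action of `ℤ` on `⊕_{n ∈ ℤ} ℤ/2ℤ` by shifting the index. -/
noncomputable def lampAction : Multiplicative ℤ →* MulAut (Multiplicative (ℤ →₀ ZMod 2)) :=
  zpowersHom _ lampShiftAut

/-- The lamplighter group `ℤ₂ ≀ ℤ = (⊕_{n ∈ ℤ} ℤ/2ℤ) ⋊ ℤ`, where `ℤ` acts by shifting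
the index. -/
noncomputable abbrev Lamplighter : Type :=
  SemidirectProduct (Multiplicative (ℤ →₀ ZMod 2)) (Multiplicative ℤ) lampAction

/-- The lamp element of the group with lamps exactly at `U`. -/
noncomputable def lampEl (U : Finset ℤ) : Lamplighter :=
  SemidirectProduct.inl (Multiplicative.ofAdd (∑ i ∈ U, Finsupp.single i (1 : ZMod 2)))

lemma lampEl_insert {i : ℤ} {U : Finset ℤ} (h : i ∉ U) :
    lampEl (insert i U) = lampEl {i} * lampEl U := by
  unfold lampEl
  rw [Finset.sum_insert h, ← map_mul, ← ofAdd_add, Finset.sum_singleton]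

lemma lampEl_comm (U V : Finset ℤ) : lampEl U * lampEl V = lampEl V * lampEl U := by
  unfold lampEl
  rw [← map_mul SemidirectProduct.inl, ← map_mul SemidirectProduct.inl, mul_comm]

lemma sum_single_apply (U : Finset ℤ) (j : ℤ) :
    (∑ i ∈ U, Finsupp.single i (1 : ZMod 2)) j = if j ∈ U then 1 else 0 := by
  rw [Finsupp.finsetSum_apply]
  simp [Finsupp.single_apply]

/-- Right multiplication by `∏ i ∈ S, (1 + s_i)`. -/
noncomputable def PP (S : Finset ℤ) (x : Lamplighter → ZMod 2) (g : Lamplighter) : ZMod 2 :=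
  ∑ U ∈ S.powerset, x (g * lampEl U)

lemma PP_insert {i : ℤ} {S : Finset ℤ} (h : i ∉ S) (x : Lamplighter → ZMod 2)
    (g : Lamplighter) : PP (insert i S) x g = PP S x g + PP S x (g * lampEl {i}) := by
  unfold PP
  rw [Finset.sum_powerset_insert h]
  congr 1
  refine Finset.sum_congr rfl fun U hU => ?_
  rw [lampEl_insert (fun hi => h (Finset.mem_powerset.1 hU hi)), mul_assoc]

lemma PP_shift (S : Finset ℤ) (x : Lamplighter → ZMod 2) (g h : Lamplighter) :
    PP S (shiftMap g x) h = PP S x (g⁻¹ * h) := by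
  simp [PP, shiftMap, mul_assoc]

lemma PP_add (S : Finset ℤ) (x y : Lamplighter → ZMod 2) (h : Lamplighter) :
    PP S (x + y) h = PP S x h + PP S y h := by
  simp [PP, Finset.sum_add_distrib]

lemma PP_smul (S : Finset ℤ) (c : ZMod 2) (y : Lamplighter → ZMod 2) (h : Lamplighter) :
    PP S (c • y) h = c * PP S y h := by
  simp [PP, Finset.mul_sum]

lemma PP_zero (S : Finset ℤ) (h : Lamplighter) : PP S 0 h = 0 := by
  simp [PP]

lemma PP_neg (S : Finset ℤ) (x : Lamplighter → ZMod 2) (h : Lamplighter) :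
    PP S (-x) h = - PP S x h := by
  simp [PP]

/-- Indices `0, …, m`. -/
noncomputable def CC (m : ℕ) : Finset ℤ := Finset.Icc 0 (m : ℤ)

/-- The index `-(m+1)`. -/
def bb (m : ℕ) : ℤ := -((m : ℤ) + 1)

lemma bb_notMem (m n : ℕ) : bb m ∉ CC n := by
  simp only [bb, CC, Finset.mem_Icc]; omega

/-- The indicator of the subgroup of lamps in `T`. -/
noncomputable def xx (T : Finset ℤ) : Lamplighter → ZMod 2 := by
  classical
  exact fun g => if g.right = 1 ∧ ∀ i ∉ T, (Multiplicative.toAdd g.left) i = 0 then 1 else 0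

lemma xx_mul {T : Finset ℤ} {i : ℤ} (hi : i ∈ T) (g : Lamplighter) :
    xx T (g * lampEl {i}) = xx T g := by
  classical
  unfold xx
  refine if_congr ?_ rfl rfl
  have h1 : (g * lampEl {i}).right = g.right := by simp [lampEl]
  rw [h1]
  refine and_congr_right fun h => ?_
  refine forall_congr' fun j => forall_congr' fun hj => ?_
  have hij : i ≠ j := fun h => hj (h ▸ hi)
  rw [SemidirectProduct.mul_left, h]
  simp [lampEl, Finsupp.single_apply, hij]

lemma xx_finite (T : Finset ℤ) : {g : Lamplighter | xx T g ≠ 0}.Finite := by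
  classical
  refine (T.powerset.image lampEl).finite_toSet.subset ?_
  intro g hg
  have hg' : g.right = 1 ∧ ∀ i ∉ T, (Multiplicative.toAdd g.left) i = 0 := by
    by_contra hc
    exact hg (by unfold xx; exact if_neg hc)
  rw [Finset.mem_coe, Finset.mem_image]
  refine ⟨(Multiplicative.toAdd g.left).support, ?_, ?_⟩
  · rw [Finset.mem_powerset]
    intro i hi
    by_contra hc
    exact Finsupp.mem_support_iff.1 hi (hg'.2 i hc)
  · refine SemidirectProduct.ext ?_ ?_
    · simp only [lampEl, SemidirectProduct.left_inl]
      apply Multiplicative.toAdd.injective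
      rw [toAdd_ofAdd]
      ext j
      rw [sum_single_apply]
      have h2 : ∀ a : ZMod 2, (if a ≠ 0 then 1 else 0) = a := by decide
      simpa using h2 ((Multiplicative.toAdd g.left) j)
    · simp [lampEl, hg'.1]

lemma PP_xx_zero {S T : Finset ℤ} {i : ℤ} (hS : i ∈ S) (hT : i ∈ T) (g : Lamplighter) :
    PP S (xx T) g = 0 := by
  classical
  rw [← Finset.insert_erase hS, PP_insert (Finset.notMem_erase i S)]
  have : PP (S.erase i) (xx T) (g * lampEl {i}) = PP (S.erase i) (xx T) g := by
    unfold PP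
    refine Finset.sum_congr rfl fun U _ => ?_
    rw [mul_assoc, lampEl_comm, ← mul_assoc, xx_mul hT]
  rw [this]
  exact CharTwo.add_self_eq_zero _

lemma PP_xx_one {S T : Finset ℤ} (h : Disjoint S T) : PP S (xx T) 1 = 1 := by
  classical
  unfold PP
  rw [Finset.sum_eq_single ∅]
  · simp [xx, lampEl]
  · intro U hU hne
    obtain ⟨i, hi⟩ := Finset.nonempty_iff_ne_empty.2 hne
    unfold xx
    refine if_neg fun hc => ?_
    have h3 := hc.2 i (Finset.disjoint_left.1 h (Finset.mem_powerset.1 hU hi))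
    rw [one_mul] at h3
    simp only [lampEl, SemidirectProduct.left_inl, toAdd_ofAdd] at h3
    rw [sum_single_apply, if_pos hi] at h3
    exact one_ne_zero h3
  · simp

/-- The subshift. -/
noncomputable def XX : Submodule (ZMod 2) (Lamplighter → ZMod 2) where
  carrier := {x | ∀ (k : ℕ) (g : Lamplighter), PP (insert (bb k) (CC k)) x g = 0}
  add_mem' := by
    intro x y hx hy k g
    rw [PP_add, hx, hy, add_zero]
  zero_mem' := fun k g => PP_zero _ _
  smul_mem' := by
    intro c x hx k g
    rw [PP_smul, hx, mul_zero]

lemma mem_XX (x : Lamplighter → ZMod 2) :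
    x ∈ XX ↔ ∀ (k : ℕ) (g : Lamplighter), PP (insert (bb k) (CC k)) x g = 0 := Iff.rfl

/-- Finitely supported elements of `XX` are killed by `CC m` if differences of support elements
have no lamp at `bb m`. -/
lemma PP_CC_zero {x : Lamplighter → ZMod 2} (hx : x ∈ XX) (m : ℕ)
    (hm : ∀ h h', x h ≠ 0 → x h' ≠ 0 → (Multiplicative.toAdd (h⁻¹ * h').left) (bb m) = 0)
    (g : Lamplighter) : PP (CC m) x g = 0 := by
  have h0 := (mem_XX x).1 hx m g
  rw [PP_insert (bb_notMem m m)] at h0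
  by_contra hne
  have hne2 : PP (CC m) x (g * lampEl {bb m}) ≠ 0 := by
    intro h
    rw [h, add_zero] at h0
    exact hne h0
  obtain ⟨U, hU, hU'⟩ := Finset.exists_ne_zero_of_sum_ne_zero hne
  obtain ⟨V, hV, hV'⟩ := Finset.exists_ne_zero_of_sum_ne_zero hne2
  have h1 := hm _ _ hU' hV'
  have hbU : bb m ∉ U := fun h => bb_notMem m m (Finset.mem_powerset.1 hU h)
  have hbV : bb m ∉ V := fun h => bb_notMem m m (Finset.mem_powerset.1 hV h)
  have h2 : (g * lampEl U)⁻¹ * (g * lampEl {bb m} * lampEl V)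
      = (lampEl U)⁻¹ * (lampEl {bb m} * lampEl V) := by group
  rw [h2, ← lampEl_insert hbV] at h1
  unfold lampEl at h1
  rw [← map_inv, ← map_mul, SemidirectProduct.left_inl, toAdd_mul, toAdd_inv, toAdd_ofAdd,
    toAdd_ofAdd, Finsupp.add_apply, Finsupp.neg_apply, sum_single_apply, sum_single_apply,
    if_neg hbU, if_pos (Finset.mem_insert_self _ _)] at h1
  simp at h1

lemma eventually_good {x : Lamplighter → ZMod 2} (hx : {g | x g ≠ 0}.Finite) :
    ∀ᶠ m : ℕ in Filter.atTop, ∀ h h', x h ≠ 0 → x h' ≠ 0 →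
      (Multiplicative.toAdd (h⁻¹ * h').left) (bb m) = 0 := by
  have key : ∀ v : ℤ →₀ ZMod 2, ∀ᶠ m : ℕ in Filter.atTop, v (bb m) = 0 := by
    intro v
    have hinj : Function.Injective bb := by
      intro a b h
      simp only [bb] at h
      omega
    have hf : (bb ⁻¹' (v.support : Set ℤ)).Finite :=
      v.support.finite_toSet.preimage hinj.injOn
    have := hf.eventually_cofinite_notMem
    rw [Nat.cofinite_eq_atTop] at this
    filter_upwards [this] with m hm
    simpa using hm
  have h1 := (Filter.eventually_all_finite (l := Filter.atTop)
    (p := fun (q : Lamplighter × Lamplighter) (m : ℕ) =>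
      (Multiplicative.toAdd (q.1⁻¹ * q.2).left) (bb m) = 0) (hx.prod hx)).2 
      (fun q _ => key _)
  filter_upwards [h1] with m hm h h' hh hh'
  exact hm (h, h') ⟨hh, hh'⟩

/-- Let `G` be the lamplighter group `ℤ₂ ≀ ℤ`.  There is a closed
`G`-shift-invariant `𝔽₂`-linear subspace `X` of `(ℤ/2ℤ)^G` whose set `Δ_X` of finitely
supported elements is not finitely orbit-generated: no finite `F ⊆ Δ_X` is such that
`Δ_X` equals the subgroup of `(X, +)` generated by the `G`-translates of elements
of `F`. -/
theorem exists_nonFOG_vector_shift_on_lamplighter :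
    ∃ X : Submodule (ZMod 2) (Lamplighter → ZMod 2),
      IsClosed (X : Set (Lamplighter → ZMod 2)) ∧
      (∀ (g : Lamplighter), ∀ x ∈ X, shiftMap g x ∈ X) ∧
      ¬ ∃ F : Set (Lamplighter → ZMod 2), F.Finite ∧
          F ⊆ deltaOf (X : Set (Lamplighter → ZMod 2)) ∧
          deltaOf (X : Set (Lamplighter → ZMod 2)) =
            (AddSubgroup.closure
              {z | ∃ (g : Lamplighter) (y : Lamplighter → ZMod 2),
                y ∈ F ∧ z = shiftMap g y} : Set (Lamplighter → ZMod 2)) := by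
  classical
  refine ⟨XX, ?_, ?_, ?_⟩
  · have : (XX : Set (Lamplighter → ZMod 2)) =
        ⋂ (k : ℕ) (g : Lamplighter), {x | PP (insert (bb k) (CC k)) x g = 0} := by
      ext x
      simp [mem_XX]
    rw [this]
    refine isClosed_iInter fun k => isClosed_iInter fun g => ?_
    refine isClosed_eq ?_ continuous_const
    unfold PP
    exact continuous_finsetSum _ fun U _ => continuous_apply _
  · intro g x hx k h
    rw [PP_shift]
    exact hx k _
  · rintro ⟨F, hF, hFX, hEq⟩
    have hev := (Filter.eventually_all_finite (l := Filter.atTop)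
      (p := fun (x : Lamplighter → ZMod 2) (m : ℕ) => ∀ h h', x h ≠ 0 → x h' ≠ 0 →
        (Multiplicative.toAdd (h⁻¹ * h').left) (bb m) = 0) hF).2
        (fun x hx => eventually_good (hFX hx).2)
    obtain ⟨m, hm⟩ := hev.exists
    set T : Finset ℤ := insert ((m : ℤ) + 1) ((Finset.range (m + 1)).image bb) with hT
    have hx : xx T ∈ deltaOf (XX : Set (Lamplighter → ZMod 2)) := by
      refine ⟨?_, xx_finite T⟩
      intro k g
      by_cases hk : k ≤ m
      · refine PP_xx_zero (i := bb k) (Finset.mem_insert_self _ _) ?_ g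
        refine Finset.mem_insert_of_mem (Finset.mem_image_of_mem _ ?_)
        rw [Finset.mem_range]; omega
      · refine PP_xx_zero (i := (m : ℤ) + 1) (Finset.mem_insert_of_mem ?_)
          (Finset.mem_insert_self _ _) g
        rw [CC, Finset.mem_Icc]; omega
    rw [hEq] at hx
    have hall : ∀ y ∈ AddSubgroup.closure {z | ∃ (g : Lamplighter) (y : Lamplighter → ZMod 2),
        y ∈ F ∧ z = shiftMap g y}, ∀ g, PP (CC m) y g = 0 := by
      intro y hy
      induction hy using AddSubgroup.closure_induction with
      | mem z hz =>
        obtain ⟨g, y, hy, rfl⟩ := hz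
        intro h
        rw [PP_shift]
        exact PP_CC_zero (hFX hy).1 m (hm y hy) _
      | zero => exact fun g => PP_zero _ _
      | add a b _ _ ha hb => intro g; rw [PP_add, ha, hb, add_zero]
      | neg a _ ha => intro g; rw [PP_neg, ha, neg_zero]
    have h0 := hall _ hx 1
    rw [PP_xx_one] at h0
    · exact one_ne_zero h0
    · rw [Finset.disjoint_left]
      intro i hi hiT
      rw [hT, Finset.mem_insert, Finset.mem_image] at hiT
      rcases hiT with rfl | ⟨j, _, rfl⟩
      · rw [CC, Finset.mem_Icc] at hi; omega
      · exact bb_notMem _ _ hi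
end

section
/- Let A be a finite group and X ⊆ A^ℤ a closed shift-invariant subgroup of the full shift A^ℤ (with pointwise group multiplication and the shift σ(x)_n = x_{n−1}). Let Δ_X = {z ∈ X : z_n = 1_A for all but finitely many n ∈ ℤ}. Let Y be a compact metric space with a homeomorphism T : Y → Y, and let φ : X → Y be a continuous surjection satisfying φ ∘ σ = T ∘ φ. If there exist x ∈ X and z ∈ Δ_X with φ(x) ≠ φ(x·z), then the topological entropy of T is strictly positive. -/
open Dynamics

/-- The shift `σ` on the full shift `A^ℤ`: `σ(x)_n = x_{n−1}`. -/
def shiftZ {A : Type} (x : ℤ → A) : ℤ → A := fun n => x (n - 1)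

/-- The inverse shift on the full shift `A^ℤ`: `x ↦ (n ↦ x_{n+1})`. -/
def shiftZInv {A : Type} (x : ℤ → A) : ℤ → A := fun n => x (n + 1)


theorem shiftZ_iterate_apply {A : Type} (x : ℤ → A) (k : ℕ) (n : ℤ) :
    (shiftZ^[k] x) n = x (n - k) := by
  induction k generalizing n with
  | zero => simp
  | succ k ih =>
    rw [Function.iterate_succ_apply', shiftZ, ih]
    congr 1
    push_cast
    ring

theorem shiftZ_iterate_mem {A : Type} [Group A] (X : Subgroup (ℤ → A))
    (hshift : ∀ x ∈ X, shiftZ x ∈ X) (x : ℤ → A) (hx : x ∈ X) (k : ℕ) :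
    shiftZ^[k] x ∈ X := by
  induction k with
  | zero => simpa
  | succ k ih =>
    rw [Function.iterate_succ_apply']
    exact hshift _ ih

/-- Recurrence from Haar measure. -/
theorem exists_recurrent
    (A : Type) [Group A] [Fintype A] [TopologicalSpace A] [DiscreteTopology A]
    (X : Subgroup (ℤ → A))
    (hclosed : IsClosed (X : Set (ℤ → A)))
    (hshift : ∀ x ∈ X, shiftZ x ∈ X)
    (hshift' : ∀ x ∈ X, shiftZInv x ∈ X)
    (x : ℤ → A) (hx : x ∈ X) (R : ℤ) (L : ℕ) :
    ∃ q : ℕ, 0 < q ∧ ∀ r : ℕ, ∃ y ∈ X, ∃ K : Finset ℕ, K ⊆ Finset.range (q * r) ∧ r ≤ K.card ∧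
      ∀ k ∈ K, ∀ j : ℤ, |j| ≤ R → y (j - (k * L : ℕ)) = x j := by
  classical
  haveI : CompactSpace X := isCompact_iff_compactSpace.mp hclosed.isCompact
  letI : MeasurableSpace X := borel X
  haveI : BorelSpace X := ⟨rfl⟩
  let s : X →* X :=
    { toFun := fun y => ⟨shiftZ y.1, hshift _ y.2⟩
      map_one' := rfl
      map_mul' := fun _ _ => rfl }
  have hscont : Continuous s := by
    refine Continuous.subtype_mk ?_ _
    refine continuous_pi fun n => ?_
    exact (continuous_apply (n - 1)).comp continuous_subtype_val
  have hssurj : Function.Surjective s := by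
    intro y
    refine ⟨⟨shiftZInv y.1, hshift' _ y.2⟩, ?_⟩
    apply Subtype.ext
    funext n
    change y.1 (n - 1 + 1) = y.1 n
    simp
  let μ : MeasureTheory.Measure X := MeasureTheory.Measure.haarMeasure ⊤
  haveI : MeasureTheory.IsProbabilityMeasure μ := ⟨by
    have := MeasureTheory.Measure.haarMeasure_self (K₀ := (⊤ : TopologicalSpace.PositiveCompacts X))
    simpa using this⟩
  have hmp : MeasureTheory.MeasurePreserving s μ μ :=
    MonoidHom.measurePreserving hscont hssurj rfl
  have hit : ∀ (k : ℕ) (y : X), ((s^[k] y : X) : ℤ → A) = shiftZ^[k] y.1 := by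
    intro k y
    induction k with
    | zero => rfl
    | succ k ih =>
      rw [Function.iterate_succ_apply', Function.iterate_succ_apply', ← ih]
      rfl
  let U : Set X := {y | ∀ j : ℤ, |j| ≤ R → y.1 j = x j}
  have hUopen : IsOpen U := by
    have hU : U = ⋂ j ∈ Set.Icc (-R) R, {y : X | y.1 j = x j} := by
      ext y
      simp [U, abs_le]
    rw [hU]
    refine (Set.finite_Icc _ _).isOpen_biInter fun j _ => ?_
    have hc : Continuous fun y : X => y.1 j := (continuous_apply j).comp continuous_subtype_val
    exact (isOpen_discrete ({x j} : Set A)).preimage hc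
  have hUne : U.Nonempty := ⟨⟨x, hx⟩, fun j _ => rfl⟩
  have hUpos : μ U ≠ 0 := (hUopen.measure_pos μ hUne).ne'
  obtain ⟨q, hq⟩ := ENNReal.exists_inv_nat_lt hUpos
  have hq0 : 0 < q := by
    rcases Nat.eq_zero_or_pos q with h | h
    · subst h; simp at hq
    · exact h
  refine ⟨q, hq0, fun r => ?_⟩
  let V : ℕ → Set X := fun k => (s^[k * L]) ⁻¹' U
  have hVm : ∀ k, MeasurableSet (V k) := fun k =>
    (hmp.iterate (k * L)).measurable hUopen.measurableSet
  have hVμ : ∀ k, μ (V k) = μ U := fun k =>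
    (hmp.iterate (k * L)).measure_preimage hUopen.measurableSet.nullMeasurableSet
  have hint : ∫⁻ y, (∑ k ∈ Finset.range (q * r), (V k).indicator (1 : X → ENNReal) y) ∂μ
      = (q * r : ℕ) * μ U := by
    rw [MeasureTheory.lintegral_finsetSum _ (fun k _ => measurable_one.indicator (hVm k))]
    simp [MeasureTheory.lintegral_indicator_one, hVm, hVμ]
  obtain ⟨y, hy⟩ := MeasureTheory.exists_lintegral_le (μ := μ)
    (f := fun y => ∑ k ∈ Finset.range (q * r), (V k).indicator (1 : X → ENNReal) y)
    (by rw [hint]; exact ENNReal.mul_ne_top (ENNReal.natCast_ne_top _) (MeasureTheory.measure_ne_top _ _))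
  rw [hint] at hy
  refine ⟨y.1, y.2, (Finset.range (q * r)).filter (fun k => y ∈ V k), Finset.filter_subset _ _,
    ?_, ?_⟩
  · have h1 : (∑ k ∈ Finset.range (q * r), (V k).indicator (1 : X → ENNReal) y)
        = (((Finset.range (q * r)).filter (fun k => y ∈ V k)).card : ENNReal) := by
      simp [Set.indicator_apply, Finset.sum_ite]
    rw [h1] at hy
    have h2 : (r : ENNReal) ≤ (q * r : ℕ) * μ U := by
      calc (r : ENNReal) = (q * r : ℕ) * (q : ENNReal)⁻¹ := by
            push_cast
            rw [mul_right_comm, ENNReal.mul_inv_cancel (by exact_mod_cast hq0.ne')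
              (ENNReal.natCast_ne_top _), one_mul]
        _ ≤ _ := by gcongr
    exact_mod_cast h2.trans hy
  · intro k hk j hj
    have h := (Finset.mem_filter.mp hk).2
    have h3 : (s^[k * L] y).1 j = x j := h j hj
    rw [hit, shiftZ_iterate_apply] at h3
    exact h3

/-- Independent insertion of shifts of a homoclinic point. -/
theorem exists_insert {A : Type} [Group A] (X : Subgroup (ℤ → A))
    (hshift : ∀ x ∈ X, shiftZInv x ∈ X) (hsh : ∀ x ∈ X, shiftZ x ∈ X) (z : ℤ → A) (hz : z ∈ X) (R : ℤ) (L : ℕ)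
    (hL : 2 * R < L) (hR : ∀ n, R < |n| → z n = 1) (S : Finset ℕ) :
    ∃ w ∈ X, ∀ k : ℕ, ∀ j : ℤ, |j| ≤ R →
      w (j - (k * L : ℕ)) = if k ∈ S then z j else 1 := by
  classical
  have hinv : ∀ m : ℕ, (fun n : ℤ => z (n + m)) ∈ X := by
    intro m
    induction m with
    | zero => simpa using hz
    | succ m ih =>
      have := hshift _ ih
      convert this using 1
      funext n
      simp only [shiftZInv]
      congr 1
      push_cast
      ring
  induction S using Finset.induction_on with
  | empty => exact ⟨1, X.one_mem, by simp⟩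
  | insert a S ha ih =>
    obtain ⟨w, hw, h⟩ := ih
    refine ⟨w * fun n : ℤ => z (n + (a * L : ℕ)), X.mul_mem hw (hinv _), fun k j hj => ?_⟩
    rw [Pi.mul_apply, h k j hj]
    by_cases hka : k = a
    · subst hka
      simp [ha]
    · have h1 : z (j - (k * L : ℕ) + (a * L : ℕ)) = 1 := by
        apply hR
        have hR0 : 0 ≤ R := (abs_nonneg j).trans hj
        rw [abs_le] at hj
        rw [lt_abs]
        push_cast
        rcases lt_or_gt_of_ne hka with hlt | hlt
        · left
          have : ((k : ℤ) + 1) * L ≤ a * L := by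
            apply mul_le_mul_of_nonneg_right _ (by positivity)
            exact_mod_cast hlt
          linarith
        · right
          have : ((a : ℤ) + 1) * L ≤ k * L := by
            apply mul_le_mul_of_nonneg_right _ (by positivity)
            exact_mod_cast hlt
          linarith
      rw [h1]
      simp [hka]

/-- Continuity at a point, expressed with windows. -/
theorem exists_window
    {A : Type} [TopologicalSpace A] [DiscreteTopology A] {X : Set (ℤ → A)}
    {Y : Type} [MetricSpace Y] {φ : (ℤ → A) → Y} (hφ : ContinuousOn φ X)
    {x : ℤ → A} (hx : x ∈ X) {ε : ℝ} (hε : 0 < ε) :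
    ∃ R : ℤ, ∀ y ∈ X, (∀ j : ℤ, |j| ≤ R → y j = x j) → dist (φ y) (φ x) < ε := by
  have h := hφ x hx (Metric.ball_mem_nhds (φ x) hε)
  rw [Filter.mem_map, mem_nhdsWithin_iff_exists_mem_nhds_inter] at h
  obtain ⟨u, hu, hsub⟩ := h
  rw [nhds_pi, Filter.mem_pi] at hu
  obtain ⟨I, hI, t, ht, htu⟩ := hu
  obtain ⟨R, hR⟩ := (hI.image (fun j : ℤ => |j|)).bddAbove
  refine ⟨R, fun y hy hj => ?_⟩
  apply hsub ⟨htu ?_, hy⟩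
  intro i hi
  rw [hj i (hR ⟨i, hi, rfl⟩)]
  exact mem_of_mem_nhds (ht i)

/-- Let `A` be a finite group and `X ⊆ A^ℤ` a closed shift-invariant
subgroup (a group shift), with homoclinic group `Δ_X` consisting of the points of `X`
equal to `1` in all but finitely many coordinates.  Let `T` be a homeomorphism of a
compact metric space `Y` and `φ : X → Y` a continuous surjection with `φ ∘ σ = T ∘ φ`.
If `φ` does not collapse some homoclinic pair, i.e. there are `x ∈ X` and `z ∈ Δ_X`
with `φ(x) ≠ φ(x·z)`, then the topological entropy of `T` is strictly positive. -/
theorem pos_entropy_of_noncollapsed_homoclinic_pair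
    (A : Type) [Group A] [Fintype A] [TopologicalSpace A] [DiscreteTopology A]
    (X : Subgroup (ℤ → A))
    (hclosed : IsClosed (X : Set (ℤ → A)))
    (hshift : ∀ x ∈ X, shiftZ x ∈ X)
    (hshift' : ∀ x ∈ X, shiftZInv x ∈ X)
    (Y : Type) [MetricSpace Y] [CompactSpace Y]
    (T : Y ≃ₜ Y)
    (φ : (ℤ → A) → Y)
    (hφcont : ContinuousOn φ (X : Set (ℤ → A)))
    (hφsurj : Set.SurjOn φ (X : Set (ℤ → A)) Set.univ)
    (hφsemiconj : ∀ x ∈ X, φ (shiftZ x) = T (φ x))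
    (hsep : ∃ x ∈ X, ∃ z ∈ X, {n : ℤ | z n ≠ 1}.Finite ∧ φ x ≠ φ (x * z)) :
    0 < coverEntropy (T : Y → Y) Set.univ := by
  classical
  obtain ⟨x, hx, z, hz, hzfin, hne⟩ := hsep
  have hε : 0 < dist (φ x) (φ (x * z)) / 4 := by
    have := dist_pos.mpr hne
    positivity
  set ε := dist (φ x) (φ (x * z)) / 4 with hεdef
  obtain ⟨R₁, hR₁⟩ := exists_window hφcont hx hε
  obtain ⟨R₂, hR₂⟩ := exists_window hφcont (X.mul_mem hx hz) hε
  obtain ⟨R₃, hR₃⟩ := (hzfin.image (fun j : ℤ => |j|)).bddAbove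
  obtain ⟨R, hRa, hRb, hRc⟩ : ∃ R : ℤ, R₁ ≤ R ∧ R₂ ≤ R ∧ R₃ ≤ R :=
    ⟨max R₁ (max R₂ R₃), by simp, by simp, by simp⟩
  have hzR : ∀ n, R < |n| → z n = 1 := by
    intro n hn
    by_contra hc
    have : |n| ≤ R₃ := hR₃ ⟨n, hc, rfl⟩
    omega
  obtain ⟨L, hL0, hL⟩ : ∃ L : ℕ, 0 < L ∧ 2 * R < L := ⟨(2 * R).toNat + 1, by omega, by omega⟩
  obtain ⟨q, hq0, hq⟩ := exists_recurrent A X hclosed hshift hshift' x hx R L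
  have hTit : ∀ (k : ℕ) (y : ℤ → A), y ∈ X → (T : Y → Y)^[k] (φ y) = φ (shiftZ^[k] y) := by
    intro k y hy
    induction k with
    | zero => rfl
    | succ k ih =>
      rw [Function.iterate_succ_apply', Function.iterate_succ_apply', ih,
        hφsemiconj _ (shiftZ_iterate_mem X hshift y hy k)]
  let U : SetRel Y Y := {p | dist p.1 p.2 < ε}
  have hU : U ∈ uniformity Y := Metric.dist_mem_uniformity hε
  have key : ∀ r : ℕ, ((2 ^ r : ℕ) : ℕ∞) ≤ netMaxcard (T : Y → Y) Set.univ U (q * L * r) := by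
    intro r
    obtain ⟨y, hy, K, hKr, hKc, hK⟩ := hq r
    choose w hwX hw using fun S : Finset ℕ => exists_insert X hshift' hshift z hz R L hL hzR S
    have hpX : ∀ S, y * w S ∈ X := fun S => X.mul_mem hy (hwX S)
    have hin : ∀ S, ∀ k ∈ K, k ∈ S →
        dist ((T : Y → Y)^[k * L] (φ (y * w S))) (φ (x * z)) < ε := by
      intro S k hk hkS
      rw [hTit _ _ (hpX S)]
      apply hR₂ _ (shiftZ_iterate_mem X hshift _ (hpX S) _)
      intro j hj
      rw [shiftZ_iterate_apply, Pi.mul_apply, Pi.mul_apply, hK k hk j (hj.trans hRb),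
        hw S k j (hj.trans hRb), if_pos hkS]
    have hout : ∀ S, ∀ k ∈ K, k ∉ S →
        dist ((T : Y → Y)^[k * L] (φ (y * w S))) (φ x) < ε := by
      intro S k hk hkS
      rw [hTit _ _ (hpX S)]
      apply hR₁ _ (shiftZ_iterate_mem X hshift _ (hpX S) _)
      intro j hj
      rw [shiftZ_iterate_apply, Pi.mul_apply, hK k hk j (hj.trans hRa),
        hw S k j (hj.trans hRa), if_neg hkS, mul_one]
    -- common points of dynamical balls force equality
    have hsepk : ∀ S S' : Finset ℕ, ∀ k ∈ K, k ∈ S → k ∉ S' → ∀ v : Y,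
        dist ((T : Y → Y)^[k * L] (φ (y * w S))) v < ε →
        dist ((T : Y → Y)^[k * L] (φ (y * w S'))) v < ε → False := by
      intro S S' k hk hkS hkS' v h1 h2
      have h3 := hin S k hk hkS
      have h4 := hout S' k hk hkS'
      have h5 : dist (φ x) (φ (x * z)) = 4 * ε := by rw [hεdef]; ring
      have h6 := dist_triangle4 (φ x) ((T : Y → Y)^[k * L] (φ (y * w S'))) v (φ (x * z))
      have h7 := dist_triangle v ((T : Y → Y)^[k * L] (φ (y * w S))) (φ (x * z))
      rw [dist_comm] at h4
      rw [dist_comm] at h1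
      linarith
    have hmain : ∀ S ∈ K.powerset, ∀ S' ∈ K.powerset, S ≠ S' → ∀ v : Y,
        v ∈ UniformSpace.ball (φ (y * w S)) (dynEntourage (T : Y → Y) U (q * L * r)) →
        v ∈ UniformSpace.ball (φ (y * w S')) (dynEntourage (T : Y → Y) U (q * L * r)) →
        False := by
      intro S hS S' hS' hne v h1 h2
      rw [mem_ball_dynEntourage] at h1 h2
      have hlt : ∀ k ∈ K, k * L < q * L * r := by
        intro k hk
        have := Finset.mem_range.mp (hKr hk)
        calc k * L < q * r * L := Nat.mul_lt_mul_of_pos_right this hL0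
          _ = q * L * r := by ring
      rw [Finset.mem_powerset] at hS hS'
      apply hne
      ext k
      constructor
      · intro hk
        by_contra hk'
        exact hsepk S S' k (hS hk) hk hk' _ (h1 _ (hlt k (hS hk))) (h2 _ (hlt k (hS hk)))
      · intro hk
        by_contra hk'
        exact hsepk S' S k (hS' hk) hk hk' _ (h2 _ (hlt k (hS' hk))) (h1 _ (hlt k (hS' hk)))
    have hUrefl : ∀ a : Y, a ∈ UniformSpace.ball a (dynEntourage (T : Y → Y) U (q * L * r)) := by
      intro a
      rw [mem_ball_dynEntourage]
      intro k _
      change dist _ _ < ε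
      rw [dist_self]
      exact hε
    have hnet : IsDynNetIn (T : Y → Y) Set.univ U (q * L * r)
        ((K.powerset.image fun S => φ (y * w S) : Finset Y) : Set Y) := by
      refine ⟨Set.subset_univ _, ?_⟩
      intro a ha b hb hab
      simp only [Finset.coe_image, Set.mem_image, Finset.mem_coe] at ha hb
      obtain ⟨S, hS, rfl⟩ := ha
      obtain ⟨S', hS', rfl⟩ := hb
      have hSS : S ≠ S' := fun h => hab (by rw [h])
      exact Set.disjoint_left.mpr fun v h1 h2 => hmain S hS S' hS' hSS v h1 h2
    have hcard : (K.powerset.image fun S => φ (y * w S)).card = 2 ^ K.card := by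
      rw [Finset.card_image_of_injOn, Finset.card_powerset]
      intro S hS S' hS' heq
      by_contra hSS
      refine hmain S hS S' hS' hSS _ (hUrefl _) ?_
      have heq' : φ (y * w S) = φ (y * w S') := heq
      rw [heq']
      exact hUrefl _
    refine le_trans ?_ hnet.card_le_netMaxcard
    rw [hcard]
    exact_mod_cast Nat.pow_le_pow_right (by norm_num) hKc
  have hpos : 0 < netEntropyEntourage (T : Y → Y) Set.univ U := by
    have hmono : Monotone fun n : ℕ =>
        ((netMaxcard (T : Y → Y) Set.univ U n : ℕ∞) : ENNReal) :=
      fun _ _ h => ENat.toENNReal_mono (netMaxcard_monotone_time _ _ _ h)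
    have hm : q * L ≠ 0 := (Nat.mul_pos hq0 hL0).ne'
    have h1 := hmono.expGrowthSup_comp_mul hm
    have h2 : ENNReal.log 2 ≤ ((q * L : ℕ) : EReal) * netEntropyEntourage (T : Y → Y) Set.univ U := by
      rw [netEntropyEntourage, ← h1, ← ExpGrowth.expGrowthSup_pow]
      apply ExpGrowth.expGrowthSup_monotone
      intro r
      have := ENat.toENNReal_mono (key r)
      simpa using this
    have h3 : (0 : EReal) < ENNReal.log 2 := by
      rw [ENNReal.zero_lt_log_iff]; norm_num
    by_contra hcon
    have h4 := mul_nonpos_of_nonneg_of_nonpos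
      (a := ((q * L : ℕ) : EReal)) (by positivity) (not_lt.mp hcon)
    exact absurd (h3.trans_le (h2.trans h4)) (lt_irrefl _)
  exact hpos.trans_le (netEntropyEntourage_le_coverEntropy _ _ hU)
end
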